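/- arXiv:1708.02783 — 2 statements merged into one kernel-verified Lean document; each statement's English description precedes it below -/
import Mathlib

section
/- Let w = (w_1, …, w_n) ∈ 𝒯_n, i.e. w ∈ 𝒮_n is not a permutation of (1, …, n). Then for all k, H_k⟦w_n, …, w_1⟧ ≅ H_{binom(n,2) − k − 1}⟦w_1, …, w_n⟧ (duality for the torsion homology of the weight summands). -/
namespace Nil

/-- Index pairs `(a,b)` with `a < b` in `Fin n`, indexing the basis `e_{ab}` of `nil_n`. -/
abbrev P (n : ℕ) : Type := {p : Fin n × Fin n // p.1 < p.2}

/-- Lexicographic key of a pair. -/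
def key {n : ℕ} (p : P n) : ℕ := p.1.1.1 * n + p.1.2.1

/-- Position (0-based) of `a` in the lexicographically sorted list of `M`. -/
def pos {n : ℕ} (M : Finset (P n)) (a : P n) : ℕ :=
  (M.filter fun b => key b < key a).card

/-- Basis of the degree `k` part of the Chevalley-Eilenberg complex `Λ^* nil_n`:
subsets `M` of pairs with `|M| = k` (empty for `k < 0`). -/
abbrev B (n : ℕ) (k : ℤ) : Type := {M : Finset (P n) // (M.card : ℤ) = k}

/-- Degree `k` chain group of the Chevalley-Eilenberg complex of `nil_n`. -/
abbrev C (n : ℕ) (k : ℤ) : Type := B n k →₀ ℤ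

/-- The Chevalley-Eilenberg boundary of a basis wedge `e_M`:
`∂(e_{a₁b₁} ∧ … ∧ e_{aₖbₖ}) = Σ_{i<j} (-1)^{i+j} [e_{aᵢbᵢ}, e_{aⱼbⱼ}] ∧ …` (omitting
the i-th and j-th factors), written in the lexicographically sorted basis.
For lexicographically sorted wedges the only nonzero brackets come from pairs
`a = (x,y)`, `b = (y,z)`, producing `±e_{(x,z)}`. -/
noncomputable def dAux {n : ℕ} (k : ℤ) (M : Finset (P n)) : C n k :=
  ∑ a ∈ M, ∑ b ∈ M,
    if hab : a.1.2 = b.1.1 then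
      (let c : P n := ⟨(a.1.1, b.1.2), lt_trans a.2 (by rw [hab]; exact b.2)⟩
       let M' : Finset (P n) := insert c ((M.erase a).erase b)
       if h' : (M'.card : ℤ) = k then
         ((-1 : ℤ) ^ (pos M a + pos M b + pos M' c)) • Finsupp.single (⟨M', h'⟩ : B n k) 1
       else 0)
    else 0

/-- The Chevalley-Eilenberg boundary map in degree `k+1`. -/
noncomputable def d (n : ℕ) (k : ℤ) : C n (k + 1) →ₗ[ℤ] C n k :=
  Finsupp.lsum ℤ fun M => LinearMap.toSpanSingleton ℤ (C n k) (dAux k M.1)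

/-- Degree-cast isomorphism. -/
noncomputable def castC (n : ℕ) {k l : ℤ} (h : k = l) : C n k ≃ₗ[ℤ] C n l :=
  Finsupp.domLCongr (Equiv.subtypeEquivRight fun _ => by rw [h])

/-- The boundary map out of degree `k`. -/
noncomputable def dFrom (n : ℕ) (k : ℤ) : C n k →ₗ[ℤ] C n (k - 1) :=
  (d n (k - 1)).comp (castC n (by ring : k = k - 1 + 1)).toLinearMap

/-- Cycles of `Λ^* nil_n` in degree `k`. -/
noncomputable def Zfull (n : ℕ) (k : ℤ) : Submodule ℤ (C n k) := LinearMap.ker (dFrom n k)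

noncomputable def HnilSub (n : ℕ) (k : ℤ) : Submodule ℤ (Zfull n k) :=
  Submodule.comap (Zfull n k).subtype (LinearMap.range (d n k) ⊓ Zfull n k)

/-- `H_k(nil_n; ℤ)`: the `k`-th integral homology of the Chevalley-Eilenberg complex
of the Lie ring of strictly upper triangular `n × n` integer matrices. -/
noncomputable def Hnil (n : ℕ) (k : ℤ) : Type := Zfull n k ⧸ HnilSub n k

noncomputable instance (n : ℕ) (k : ℤ) : AddCommGroup (Hnil n k) :=
  inferInstanceAs (AddCommGroup (Zfull n k ⧸ HnilSub n k))

noncomputable instance (n : ℕ) (k : ℤ) : Module ℤ (Hnil n k) :=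
  inferInstanceAs (Module ℤ (Zfull n k ⧸ HnilSub n k))

/-- The modified weight of a basis wedge `e_M` (indices of `Fin n` are 0-based, so the
`i`-th weight of the paper, `1 ≤ i ≤ n`, is `wt M ⟨i-1,_⟩`):
`w_i(e_M) = i - #{x : (x,i) ∈ M} + #{y : (i,y) ∈ M}`. -/
def wt {n : ℕ} (M : Finset (P n)) : Fin n → ℤ := fun i =>
  ((i.1 : ℤ) + 1) - (M.filter fun p => p.1.2 = i).card + (M.filter fun p => p.1.1 = i).card

/-- Basis wedges of degree `k` and modified weight `w`. -/
abbrev Bw (n : ℕ) (k : ℤ) (w : Fin n → ℤ) : Type :=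
  {M : Finset (P n) // (M.card : ℤ) = k ∧ wt M = w}

/-- Degree `k` part of the weight summand `⟦w⟧` of `Λ^* nil_n`. -/
abbrev Cw (n : ℕ) (k : ℤ) (w : Fin n → ℤ) : Type := Bw n k w →₀ ℤ

/-- Inclusion of the weight summand. -/
noncomputable def inclW (n : ℕ) (k : ℤ) (w : Fin n → ℤ) : Cw n k w →ₗ[ℤ] C n k :=
  Finsupp.lmapDomain ℤ ℤ fun M => (⟨M.1, M.2.1⟩ : B n k)

/-- Projection onto the weight summand. -/
noncomputable def projW (n : ℕ) (k : ℤ) (w : Fin n → ℤ) : C n k →ₗ[ℤ] Cw n k w :=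
  Finsupp.lsum ℤ fun M =>
    if h : wt M.1 = w then
      LinearMap.toSpanSingleton ℤ (Cw n k w) (Finsupp.single (⟨M.1, M.2, h⟩ : Bw n k w) 1)
    else 0

/-- The boundary of the weight summand `⟦w⟧` (the boundary preserves weights, so this
is the restriction of the Chevalley-Eilenberg boundary). -/
noncomputable def dW (n : ℕ) (k : ℤ) (w : Fin n → ℤ) : Cw n (k + 1) w →ₗ[ℤ] Cw n k w :=
  (projW n k w) ∘ₗ (d n k) ∘ₗ (inclW n (k + 1) w)

noncomputable def castCw (n : ℕ) (w : Fin n → ℤ) {k l : ℤ} (h : k = l) :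
    Cw n k w ≃ₗ[ℤ] Cw n l w :=
  Finsupp.domLCongr (Equiv.subtypeEquivRight fun _ => by rw [h])

noncomputable def dFromW (n : ℕ) (k : ℤ) (w : Fin n → ℤ) : Cw n k w →ₗ[ℤ] Cw n (k - 1) w :=
  (dW n (k - 1) w).comp (castCw n w (by ring : k = k - 1 + 1)).toLinearMap

noncomputable def ZW (n : ℕ) (k : ℤ) (w : Fin n → ℤ) : Submodule ℤ (Cw n k w) :=
  LinearMap.ker (dFromW n k w)

noncomputable def HwSub (n : ℕ) (k : ℤ) (w : Fin n → ℤ) : Submodule ℤ (ZW n k w) :=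
  Submodule.comap (ZW n k w).subtype (LinearMap.range (dW n k w) ⊓ ZW n k w)

/-- `H_k⟦w⟧`: the `k`-th homology of the weight summand `⟦w⟧` of `Λ^* nil_n`. -/
noncomputable def Hw (n : ℕ) (k : ℤ) (w : Fin n → ℤ) : Type := ZW n k w ⧸ HwSub n k w

noncomputable instance (n : ℕ) (k : ℤ) (w : Fin n → ℤ) : AddCommGroup (Hw n k w) :=
  inferInstanceAs (AddCommGroup (ZW n k w ⧸ HwSub n k w))

noncomputable instance (n : ℕ) (k : ℤ) (w : Fin n → ℤ) : Module ℤ (Hw n k w) :=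
  inferInstanceAs (Module ℤ (ZW n k w ⧸ HwSub n k w))

/-- `w ∈ 𝒮_n`: all entries lie in `{1,…,n}` and they add up to `binom (n+1) 2`. -/
def Sn (n : ℕ) (w : Fin n → ℤ) : Prop :=
  (∀ i, 1 ≤ w i ∧ w i ≤ (n : ℤ)) ∧ 2 * ∑ i, w i = (n : ℤ) * ((n : ℤ) + 1)

/-- Number of inversions of a permutation of `Fin n`. -/
def invCount (n : ℕ) (π : Equiv.Perm (Fin n)) : ℕ :=
  (Finset.univ.filter fun p : Fin n × Fin n => p.1 < p.2 ∧ π p.2 < π p.1).card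

/-- The weight sequence `(π(1), …, π(n))` attached to a permutation (1-based values). -/
def permWt (n : ℕ) (π : Equiv.Perm (Fin n)) : Fin n → ℤ := fun i => ((π i).1 : ℤ) + 1

/-- The set of inversions of a permutation, as a set of index pairs. -/
def invFinset {n : ℕ} (π : Equiv.Perm (Fin n)) : Finset (P n) :=
  Finset.univ.filter fun p => π p.1.2 < π p.1.1

/-- Index reversal `i ↦ n+1-i` (0-based: `i ↦ n-1-i`). -/
def rev {n : ℕ} (i : Fin n) : Fin n := ⟨n - 1 - i.1, by have := i.isLt; omega⟩

section Duality

/-- A saturated submodule `K` whose quotient by `N` has bounded exponent is determined, together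
with `N`, by a diagonal presentation of `N`. -/
lemma quotient_equiv_of_diagonal {F : Type*} [AddCommGroup F] [Module.IsTorsionFree ℤ F]
    (N K : Submodule ℤ F) (hNK : N ≤ K)
    (hsat : ∀ (c : ℤ) (y : F), c ≠ 0 → c • y ∈ K → y ∈ K)
    {c : ℤ} (hc : c ≠ 0) (hcK : ∀ y ∈ K, c • y ∈ N)
    {r : ℕ} (e : Fin r → F) (l : Fin r → F →ₗ[ℤ] ℤ)
    (hle : ∀ i j, l i (e j) = if i = j then 1 else 0)
    (a : Fin r → ℤ) (ha : ∀ i, a i ≠ 0)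
    (hN : ∀ y, y ∈ N ↔ ∃ v : Fin r → ℤ, y = ∑ i, (v i * a i) • e i) :
    Nonempty ((K ⧸ N.comap K.subtype) ≃ₗ[ℤ]
      ((Fin r → ℤ) ⧸ Submodule.pi Set.univ fun i => Ideal.span {a i})) := by
  have heK : ∀ i, e i ∈ K := fun i => by
    refine hsat (a i) (e i) (ha i) (hNK ((hN _).2 ⟨Pi.single i 1, ?_⟩))
    rw [Finset.sum_eq_single i]
    · simp
    · intro j _ hj
      simp [hj]
    · simp
  have hrec : ∀ y ∈ K, ∑ i, l i y • e i = y := fun y hy => by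
    obtain ⟨v, hv⟩ := (hN _).1 (hcK y hy)
    have hl : ∀ i, c * l i y = v i * a i := fun i => by
      have := congrArg (l i) hv
      simpa [map_sum, hle] using this
    apply smul_right_injective F hc
    simp only [Finset.smul_sum, smul_smul, hl, hv]
  let L : F →ₗ[ℤ] (Fin r → ℤ) := LinearMap.pi l
  let G : (Fin r → ℤ) →ₗ[ℤ] K :=
    ∑ i, (LinearMap.proj i : (Fin r → ℤ) →ₗ[ℤ] ℤ).smulRight (⟨e i, heK i⟩ : K)
  have hG : ∀ v, (G v : F) = ∑ i, v i • e i := fun v => by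
    simp [G, LinearMap.sum_apply]
  let E : K ≃ₗ[ℤ] (Fin r → ℤ) := LinearEquiv.ofLinearMap (L ∘ₗ K.subtype) G
    (by
      refine LinearMap.ext fun v => funext fun i => ?_
      simp [hG, L, map_sum, hle])
    (by
      refine LinearMap.ext fun y => Subtype.ext ?_
      simp [hG, L, hrec y.1 y.2])
  refine ⟨Submodule.Quotient.equiv _ _ E ?_⟩
  ext v
  simp only [Submodule.mem_map, Submodule.mem_comap, Submodule.mem_pi, Set.mem_univ, true_imp_iff,
    Ideal.mem_span_singleton]
  constructor
  · rintro ⟨y, hy, rfl⟩ i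
    obtain ⟨u, hu⟩ := (hN _).1 hy
    have : l i y = u i * a i := by
      have := congrArg (l i) hu
      simpa [map_sum, hle] using this
    exact ⟨u i, by simp [E, L, this, mul_comm]⟩
  · intro h
    choose u hu using h
    refine ⟨E.symm v, (hN _).2 ⟨u, ?_⟩, E.apply_symm_apply v⟩
    change ((G v : K) : F) = _
    simp [hG, hu, mul_comm]

variable {ι : Type*} [Fintype ι]

/-- The pairing on `ι →₀ ℤ` making the standard basis orthonormal. -/
noncomputable def dot (x y : ι →₀ ℤ) : ℤ := ∑ i, x i * y i

lemma dot_comm (x y : ι →₀ ℤ) : dot x y = dot y x := by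
  simp [dot, mul_comm]

lemma dot_single_left (i : ι) (y : ι →₀ ℤ) : dot (Finsupp.single i 1) y = y i := by
  classical
  simp [dot, Finsupp.single_apply]

/-- `y ↦ ⟨x, y⟩` as a linear functional. -/
noncomputable def dotₗ (x : ι →₀ ℤ) : (ι →₀ ℤ) →ₗ[ℤ] ℤ where
  toFun := dot x
  map_add' y z := by simp [dot, mul_add, Finset.sum_add_distrib]
  map_smul' c y := by simp [dot, Finset.mul_sum, mul_left_comm]

@[simp] lemma dotₗ_apply (x y : ι →₀ ℤ) : dotₗ x y = dot x y := rfl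

lemma exists_dotₗ_eq (f : (ι →₀ ℤ) →ₗ[ℤ] ℤ) : ∃ x, dotₗ x = f := by
  classical
  refine ⟨Finsupp.equivFunOnFinite.symm fun i => f (Finsupp.single i 1), ?_⟩
  ext i
  simp [dot, Finsupp.single_apply]

lemma ext_dot {x y : ι →₀ ℤ} (h : ∀ z, dot z x = dot z y) : x = y := by
  ext i
  rw [← dot_single_left, ← dot_single_left, h]

lemma dot_sum_smul {κ : Type*} (s : Finset κ) (x : ι →₀ ℤ) (c : κ → ℤ) (g : κ → ι →₀ ℤ) :
    dot x (∑ i ∈ s, c i • g i) = ∑ i ∈ s, c i * dot x (g i) := by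
  rw [← dotₗ_apply, map_sum]
  simp

/-- `g` is the transpose of `f`. -/
def IsAdj (f g : Module.End ℤ (ι →₀ ℤ)) : Prop := ∀ x y, dot (f x) y = dot x (g y)

lemma IsAdj.of_single {f g : Module.End ℤ (ι →₀ ℤ)}
    (h : ∀ i j, f (Finsupp.single i 1) j = g (Finsupp.single j 1) i) : IsAdj f g := by
  have h1 : ∀ i y, dot (f (Finsupp.single i 1)) y = dot (Finsupp.single i 1) (g y) := by
    intro i y
    have : dotₗ (f (Finsupp.single i 1)) = dotₗ (Finsupp.single i 1) ∘ₗ g := by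
      refine Finsupp.lhom_ext' fun j => LinearMap.ext_ring ?_
      simp [dot_comm _ (Finsupp.single j 1), dot_single_left, h]
    exact LinearMap.congr_fun this y
  intro x y
  have : dotₗ y ∘ₗ f = dotₗ (g y) := by
    refine Finsupp.lhom_ext' fun j => LinearMap.ext_ring ?_
    simp [dot_comm _ (f _), dot_comm _ (Finsupp.single j 1), h1]
  rw [dot_comm, dot_comm x]
  exact LinearMap.congr_fun this x

lemma IsAdj.mul {f g f' g' : Module.End ℤ (ι →₀ ℤ)} (h : IsAdj f g) (h' : IsAdj f' g') :
    IsAdj (f * f') (g' * g) := fun x y => by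
  rw [Module.End.mul_apply, h, h', Module.End.mul_apply]

lemma IsAdj.symm {f g : Module.End ℤ (ι →₀ ℤ)} (h : IsAdj f g) : IsAdj g f := fun x y => by
  rw [dot_comm, ← h, dot_comm]

lemma IsAdj.sum {κ : Type*} {s : Finset κ} {f g : κ → Module.End ℤ (ι →₀ ℤ)}
    (h : ∀ i ∈ s, IsAdj (f i) (g i)) : IsAdj (∑ i ∈ s, f i) (∑ i ∈ s, g i) := fun x y => by
  rw [LinearMap.sum_apply, LinearMap.sum_apply, dot_comm, ← dotₗ_apply, ← dotₗ_apply, map_sum,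
    map_sum]
  exact Finset.sum_congr rfl fun i hi => by rw [dotₗ_apply, dot_comm, h i hi, dotₗ_apply]

/-- If `B` is the transpose of `A`, the saturations of their ranges have isomorphic quotients. -/
theorem saturation_quotient_equiv (A B : Module.End ℤ (ι →₀ ℤ)) (hAB : IsAdj A B)
    (K K' : Submodule ℤ (ι →₀ ℤ)) (hK : LinearMap.range A ≤ K) (hK' : LinearMap.range B ≤ K')
    (hs : ∀ (c : ℤ) (y : ι →₀ ℤ), c ≠ 0 → c • y ∈ K → y ∈ K)
    (hs' : ∀ (c : ℤ) (y : ι →₀ ℤ), c ≠ 0 → c • y ∈ K' → y ∈ K')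
    {c : ℤ} (hc : c ≠ 0) (hcK : ∀ y ∈ K, c • y ∈ LinearMap.range A)
    (hcK' : ∀ y ∈ K', c • y ∈ LinearMap.range B) :
    Nonempty ((K ⧸ (LinearMap.range A).comap K.subtype) ≃ₗ[ℤ]
      (K' ⧸ (LinearMap.range B).comap K'.subtype)) := by
  obtain ⟨r, bM, bN, f, a, snf⟩ :=
    (LinearMap.range A).smithNormalForm (Finsupp.basisSingleOne (R := ℤ) (ι := ι))
  have ha : ∀ i, a i ≠ 0 := fun i h => by
    have := snf i
    rw [h, zero_smul] at this
    exact bN.ne_zero i (Subtype.ext this)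
  choose x hx using fun i => (bN i).2
  choose g hg using fun i => exists_dotₗ_eq (bN.coord i ∘ₗ A.rangeRestrict)
  choose y hy using fun i => exists_dotₗ_eq (bM.coord (f i))
  have hg' : ∀ i z, dot (g i) z = bN.repr (A.rangeRestrict z) i := fun i z =>
    LinearMap.congr_fun (hg i) z
  have hA : ∀ z, A z = ∑ i, (dot (g i) z * a i) • bM (f i) := fun z => by
    have h := congrArg Subtype.val (bN.sum_repr (A.rangeRestrict z))
    simp only [AddSubmonoidClass.coe_finsetSum, Submodule.coe_smul_of_tower, snf,
      LinearMap.codRestrict_apply, LinearMap.rangeRestrict, smul_smul] at h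
    rw [← h]
    exact Finset.sum_congr rfl fun i _ => by rw [hg']
  have hxg : ∀ i j, dot (x i) (g j) = if i = j then 1 else 0 := fun i j => by
    rw [dot_comm, hg']
    have : A.rangeRestrict (x i) = bN i := Subtype.ext (hx i)
    rw [this, bN.repr_self, Finsupp.single_apply]
  have hB : ∀ z, B z = ∑ i, (dot z (bM (f i)) * a i) • g i := fun z => by
    refine ext_dot fun u => ?_
    rw [← hAB, dot_comm, hA, dot_sum_smul, dot_sum_smul]
    exact Finset.sum_congr rfl fun i _ => by rw [dot_comm (g i)]; ring
  have hye : ∀ i j, dot (y i) (bM (f j)) = if i = j then 1 else 0 := fun i j => by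
    classical
    have := LinearMap.congr_fun (hy i) (bM (f j))
    rw [dotₗ_apply] at this
    rw [this, Module.Basis.coord_apply, bM.repr_self, Finsupp.single_apply]
    simp [f.injective.eq_iff, eq_comm]
  obtain ⟨E⟩ := quotient_equiv_of_diagonal (LinearMap.range A) K hK hs hc hcK
    (fun i => bM (f i)) (fun i => bM.coord (f i))
    (fun i j => by rw [← hy, dotₗ_apply, hye]) a ha (fun z => by
      constructor
      · rintro ⟨u, rfl⟩
        exact ⟨_, hA u⟩
      · rintro ⟨v, rfl⟩
        refine ⟨∑ i, v i • x i, ?_⟩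
        simp [map_sum, hx, snf, smul_smul])
  obtain ⟨E'⟩ := quotient_equiv_of_diagonal (LinearMap.range B) K' hK' hs' hc hcK'
    g (fun i => dotₗ (x i)) (fun i j => by rw [dotₗ_apply, hxg]) a ha (fun z => by
      constructor
      · rintro ⟨u, rfl⟩
        exact ⟨_, hB u⟩
      · rintro ⟨v, rfl⟩
        refine ⟨∑ i, v i • y i, ?_⟩
        rw [hB]
        refine Finset.sum_congr rfl fun i _ => ?_
        rw [dot_comm, dot_sum_smul]
        simp [dot_comm (bM (f i)), hye])
  exact ⟨E.trans E'.symm⟩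

end Duality

section Laplacian

variable {R : Type*} [Ring R] {n : ℕ}

/-- Fermionic operators indexed by pairs `i < j`: `A i j` annihilates and `A' i j` creates. -/
structure CAR (A A' : Fin n → Fin n → R) : Prop where
  zero : ∀ i j, ¬ i < j → A i j = 0
  zero' : ∀ i j, ¬ i < j → A' i j = 0
  anti : ∀ i j k l, A i j * A k l = -(A k l * A i j)
  anti' : ∀ i j k l, A' i j * A' k l = -(A' k l * A' i j)
  mixed : ∀ i j k l, A i j * A' k l = (if i = k ∧ j = l ∧ i < j then 1 else 0) - A' k l * A i j

/-- The boundary operator in terms of fermionic operators. -/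
def bd (A A' : Fin n → Fin n → R) : R := ∑ i, ∑ j, ∑ k, A' i k * A i j * A j k

/-- The transposed boundary operator in terms of fermionic operators. -/
def cobd (A A' : Fin n → Fin n → R) : R := ∑ i, ∑ j, ∑ k, A' j k * A' i j * A i k

variable {A A' : Fin n → Fin n → R}

lemma CAR.bd_create (h : CAR A A') (a b : Fin n) (hab : a < b) :
    bd A A' * A' a b + A' a b * bd A A' = (∑ l, A' l b * A l a) - ∑ l, A' a l * A b l := by
  have key : ∀ i j k, A' i k * A i j * A j k * A' a b + A' a b * (A' i k * A i j * A j k) =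
      (if j = a ∧ k = b then A' i b * A i a else 0)
        - (if i = a ∧ j = b then A' a k * A b k else 0) := fun i j k => by
    have e1 : A' i k * A i j * A j k * A' a b + A' a b * (A' i k * A i j * A j k) =
        A' i k * A i j * (A j k * A' a b + A' a b * A j k)
          - A' i k * (A i j * A' a b + A' a b * A i j) * A j k
          + (A' i k * A' a b + A' a b * A' i k) * A i j * A j k := by noncomm_ring
    rw [e1, h.mixed j k, h.mixed i j, h.anti' i k]
    by_cases h1 : j = a ∧ k = b
    · obtain ⟨rfl, rfl⟩ := h1
      have : ¬ (i = j ∧ j = k ∧ i < j) := by rintro ⟨rfl, rfl, h⟩; exact lt_irrefl _ h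
      have h3 : ¬ (i = j ∧ j = k) := by rintro ⟨rfl, rfl⟩; exact lt_irrefl _ hab
      simp [hab, this, h3]
    · by_cases h2 : i = a ∧ j = b
      · obtain ⟨rfl, rfl⟩ := h2
        have : ¬ (j = i ∧ k = j ∧ j < k) := by rintro ⟨rfl, rfl, h⟩; exact lt_irrefl _ h
        simp [hab, this, h1]
      · have h1' : ¬ (j = a ∧ k = b ∧ j < k) := fun h => h1 ⟨h.1, h.2.1⟩
        have h2' : ¬ (i = a ∧ j = b ∧ i < j) := fun h => h2 ⟨h.1, h.2.1⟩
        simp [h1, h2, h1', h2']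
  simp only [bd, Finset.sum_mul, Finset.mul_sum, ← Finset.sum_add_distrib, key,
    Finset.sum_sub_distrib]
  congr 1
  · refine Finset.sum_congr rfl fun i _ => ?_
    simp [ite_and]
  · simp [ite_and]

lemma CAR.bd_annihilate (h : CAR A A') (a b : Fin n) (hab : a < b) :
    bd A A' * A a b + A a b * bd A A' = ∑ l, A a l * A l b := by
  have key : ∀ i j k, A' i k * A i j * A j k * A a b + A a b * (A' i k * A i j * A j k) =
      if i = a ∧ k = b then A a j * A j b else 0 := fun i j k => by
    have e1 : A' i k * A i j * A j k * A a b + A a b * (A' i k * A i j * A j k) =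
        (A a b * A' i k + A' i k * A a b) * A i j * A j k
          - A' i k * (A a b * A i j + A i j * A a b) * A j k
          + A' i k * A i j * (A j k * A a b + A a b * A j k) := by noncomm_ring
    rw [e1, h.mixed a b, h.anti a b i j, h.anti j k a b]
    by_cases h1 : i = a ∧ k = b
    · obtain ⟨rfl, rfl⟩ := h1
      simp [hab]
    · have h1' : ¬ (a = i ∧ b = k ∧ a < b) := fun h => h1 ⟨h.1.symm, h.2.1.symm⟩
      simp [h1, h1']
  simp only [bd, Finset.sum_mul, Finset.mul_sum, ← Finset.sum_add_distrib, key]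
  simp only [ite_and]
  rw [Finset.sum_eq_single a]
  · simp
  · intro b _ hb
    simp [hb]
  · simp

/-- The number operator. -/
def num (A A' : Fin n → Fin n → R) (i j : Fin n) : R := A' i j * A i j

lemma sum_swap_last {M : Type*} [AddCommMonoid M] (f : Fin n → Fin n → Fin n → Fin n → M) :
    ∑ i, ∑ j, ∑ k, ∑ l, f i j k l = ∑ i, ∑ j, ∑ k, ∑ l, f i j l k :=
  Finset.sum_congr rfl fun _ _ => Finset.sum_congr rfl fun _ _ => Finset.sum_comm

lemma sum_swap_first {M : Type*} [AddCommMonoid M] (f : Fin n → Fin n → Fin n → Fin n → M) :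
    ∑ i, ∑ j, ∑ k, ∑ l, f i j k l = ∑ i, ∑ j, ∑ k, ∑ l, f j i k l :=
  Finset.sum_comm

lemma sum_swap_mid {M : Type*} [AddCommMonoid M] (f : Fin n → Fin n → Fin n → Fin n → M) :
    ∑ i, ∑ j, ∑ k, ∑ l, f i j k l = ∑ i, ∑ j, ∑ k, ∑ l, f i k j l :=
  Finset.sum_congr rfl fun _ _ => Finset.sum_comm

lemma CAR.annihilate_create (h : CAR A A') {i j k l : Fin n} (hne : ¬ (i = k ∧ j = l)) :
    A i j * A' k l = -(A' k l * A i j) := by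
  rw [h.mixed, if_neg (fun H => hne ⟨H.1, H.2.1⟩), zero_sub]

/-- The anticommutator of the boundary operator with one summand of its transpose. -/
lemma CAR.bd_term (h : CAR A A') (i j k : Fin n) :
    bd A A' * (A' j k * A' i j * A i k) + A' j k * A' i j * A i k * bd A A' =
      ∑ l, ((if l = i ∧ i < j ∧ j < k then num A A' i k else 0)
        - (if j < k then A' l k * A' i j * (A l j * A i k) else 0)
        + (if j < k then A' j l * A' i j * (A k l * A i k) else 0)
        - (if i < j then A' j k * A' l j * (A l i * A i k) else 0)
        + (if i < j then A' j k * A' i l * (A j l * A i k) else 0)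
        + A' j k * A' i j * (A i l * A l k)) := by
  by_cases hij : i < j
  swap
  · simp [h.zero' i j hij, hij]
  by_cases hjk : j < k
  swap
  · simp [h.zero' j k hjk, hjk]
  have hik := hij.trans hjk
  have e : bd A A' * (A' j k * A' i j * A i k) + A' j k * A' i j * A i k * bd A A' =
      (bd A A' * A' j k + A' j k * bd A A') * A' i j * A i k
        - A' j k * (bd A A' * A' i j + A' i j * bd A A') * A i k
        + A' j k * A' i j * (bd A A' * A i k + A i k * bd A A') := by noncomm_ring
  rw [e, h.bd_create j k hjk, h.bd_create i j hij, h.bd_annihilate i k hik]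
  simp only [Finset.mul_sum, Finset.sum_mul, sub_mul, mul_sub, ← Finset.sum_sub_distrib,
    ← Finset.sum_add_distrib]
  refine Finset.sum_congr rfl fun l _ => ?_
  have e1 : A' l k * A l j * A' i j * A i k =
      (if l = i then num A A' i k else 0) - A' l k * A' i j * (A l j * A i k) := by
    rw [mul_assoc (A' l k), h.mixed]
    by_cases hl : l = i
    · subst hl
      simp [hij, num]
      noncomm_ring
    · simp [hl]
      noncomm_ring
  have e2 : A' j l * A k l * A' i j * A i k = -(A' j l * A' i j * (A k l * A i k)) := by
    rw [mul_assoc (A' j l), h.annihilate_create (fun H => hik.ne' H.1)]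
    noncomm_ring
  rw [e1, e2]
  simp only [hij, hjk, and_true, if_true]
  noncomm_ring

/-- The Laplacian of the boundary operator is diagonal in the number operators. -/
theorem CAR.laplacian (h : CAR A A') :
    bd A A' * cobd A A' + cobd A A' * bd A A' =
      (∑ i, ∑ j, ∑ k, if i < j ∧ j < k then num A A' i k else 0)
      + (∑ i, ∑ j, ∑ k, num A A' i j * num A A' j k)
      - (∑ i, ∑ j, ∑ k, if i < j then num A A' j k * num A A' i k else 0)
      - (∑ i, ∑ j, ∑ k, if j < k then num A A' i j * num A A' i k else 0) := by
  have e : bd A A' * cobd A A' + cobd A A' * bd A A' = ∑ i, ∑ j, ∑ k,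
      (bd A A' * (A' j k * A' i j * A i k) + A' j k * A' i j * A i k * bd A A') := by
    simp only [cobd, Finset.mul_sum, Finset.sum_mul, Finset.sum_add_distrib]
  let H : Fin n → Fin n → Fin n → Fin n → R := fun i j k l => A' j k * A' i l * (A j l * A i k)
  let G : Fin n → Fin n → Fin n → Fin n → R := fun i j k l => A' j k * A' i j * (A i l * A l k)
  have t1 : (∑ i, ∑ j, ∑ k, ∑ l, if j < k then A' l k * A' i j * (A l j * A i k) else 0) =
      ∑ i, ∑ j, ∑ k, ∑ l, if l < k then H i j k l else 0 := by
    rw [sum_swap_mid, sum_swap_last, sum_swap_mid]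
  have t2 : (∑ i, ∑ j, ∑ k, ∑ l, if j < k then A' j l * A' i j * (A k l * A i k) else 0) =
      -∑ i, ∑ j, ∑ k, ∑ l, if j < l then G i j k l else 0 := by
    rw [sum_swap_last]
    simp only [← Finset.sum_neg_distrib]
    refine Finset.sum_congr rfl fun i _ => Finset.sum_congr rfl fun j _ =>
      Finset.sum_congr rfl fun k _ => Finset.sum_congr rfl fun l _ => ?_
    split_ifs
    · rw [h.anti l k, mul_neg]
    · simp
  have t3 : (∑ i, ∑ j, ∑ k, ∑ l, if i < j then A' j k * A' l j * (A l i * A i k) else 0) =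
      ∑ i, ∑ j, ∑ k, ∑ l, if l < j then G i j k l else 0 := by
    rw [sum_swap_first, sum_swap_mid, sum_swap_last, sum_swap_mid, sum_swap_first]
  have g : (∑ i, ∑ j, ∑ k, ∑ l, G i j k l)
      - (∑ i, ∑ j, ∑ k, ∑ l, if j < l then G i j k l else 0)
      - (∑ i, ∑ j, ∑ k, ∑ l, if l < j then G i j k l else 0) =
      ∑ i, ∑ j, ∑ k, num A A' i j * num A A' j k := by
    simp only [← Finset.sum_sub_distrib]
    refine Finset.sum_congr rfl fun i _ => Finset.sum_congr rfl fun j _ =>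
      Finset.sum_congr rfl fun k _ => ?_
    rw [Finset.sum_eq_single j]
    · by_cases hij : i < j
      · have e1 : A i j * A' j k = -(A' j k * A i j) := h.annihilate_create fun H => hij.ne H.1
        calc _ = A' j k * A' i j * (A i j * A j k) := by simp [G]
          _ = -(A' i j * (A' j k * A i j) * A j k) := by rw [h.anti' j k]; noncomm_ring
          _ = A' i j * (A i j * A' j k) * A j k := by rw [e1]; noncomm_ring
          _ = _ := by simp only [num]; noncomm_ring
      · simp [G, num, h.zero' i j hij]
    · intro l _ hl
      rcases lt_or_gt_of_ne hl with hl | hl <;> simp [hl, hl.not_gt]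
    · simp
  have hsym : (∑ i, ∑ j, ∑ k, ∑ l, if l < k ∧ j < i then H i j k l else 0) =
      ∑ i, ∑ j, ∑ k, ∑ l, if k < l ∧ i < j then H i j k l else 0 := by
    rw [sum_swap_first, sum_swap_last]
    refine Finset.sum_congr rfl fun i _ => Finset.sum_congr rfl fun j _ =>
      Finset.sum_congr rfl fun k _ => Finset.sum_congr rfl fun l _ => ?_
    simp only [H]
    rw [h.anti' i l, h.anti i k]
    simp
  have hs : (∑ i, ∑ j, ∑ k, ∑ l, if i < j then H i j k l else 0)
      - (∑ i, ∑ j, ∑ k, ∑ l, if l < k then H i j k l else 0) =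
      (∑ i, ∑ j, ∑ k, ∑ l, if k = l ∧ i < j then H i j k l else 0)
      - ∑ i, ∑ j, ∑ k, ∑ l, if i = j ∧ l < k then H i j k l else 0 := by
    have d1 : (∑ i, ∑ j, ∑ k, ∑ l, if i < j then H i j k l else 0) =
        (∑ i, ∑ j, ∑ k, ∑ l, if k < l ∧ i < j then H i j k l else 0)
        + (∑ i, ∑ j, ∑ k, ∑ l, if k = l ∧ i < j then H i j k l else 0)
        + ∑ i, ∑ j, ∑ k, ∑ l, if l < k ∧ i < j then H i j k l else 0 := by
      simp only [← Finset.sum_add_distrib]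
      refine Finset.sum_congr rfl fun i _ => Finset.sum_congr rfl fun j _ =>
        Finset.sum_congr rfl fun k _ => Finset.sum_congr rfl fun l _ => ?_
      rcases lt_trichotomy k l with hl | rfl | hl
      · simp [hl, hl.not_gt, hl.ne]
      · simp
      · simp [hl, hl.not_gt, hl.ne']
    have d2 : (∑ i, ∑ j, ∑ k, ∑ l, if l < k then H i j k l else 0) =
        (∑ i, ∑ j, ∑ k, ∑ l, if l < k ∧ i < j then H i j k l else 0)
        + (∑ i, ∑ j, ∑ k, ∑ l, if i = j ∧ l < k then H i j k l else 0)
        + ∑ i, ∑ j, ∑ k, ∑ l, if l < k ∧ j < i then H i j k l else 0 := by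
      simp only [← Finset.sum_add_distrib]
      refine Finset.sum_congr rfl fun i _ => Finset.sum_congr rfl fun j _ =>
        Finset.sum_congr rfl fun k _ => Finset.sum_congr rfl fun l _ => ?_
      rcases lt_trichotomy i j with hl | rfl | hl
      · simp [hl, hl.not_gt, hl.ne]
      · simp
      · simp [hl, hl.not_gt, hl.ne']
    rw [d1, d2, hsym]
    abel
  have hs1 : (∑ i, ∑ j, ∑ k, ∑ l, if k = l ∧ i < j then H i j k l else 0) =
      -∑ i, ∑ j, ∑ k, if i < j then num A A' j k * num A A' i k else 0 := by
    simp only [← Finset.sum_neg_distrib]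
    refine Finset.sum_congr rfl fun i _ => Finset.sum_congr rfl fun j _ =>
      Finset.sum_congr rfl fun k _ => ?_
    simp only [ite_and, Finset.sum_ite_eq, Finset.mem_univ, if_true]
    split_ifs with hij
    · have e1 : A j k * A' i k = -(A' i k * A j k) := h.annihilate_create fun H => hij.ne' H.1
      calc _ = -(A' j k * -(A' i k * A j k) * A i k) := by simp only [H]; noncomm_ring
        _ = _ := by rw [← e1]; simp only [num]; noncomm_ring
    · simp
  have hs2 : (∑ i, ∑ j, ∑ k, ∑ l, if i = j ∧ l < k then H i j k l else 0) =
      ∑ i, ∑ j, ∑ k, if j < k then num A A' i j * num A A' i k else 0 := by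
    refine Finset.sum_congr rfl fun i _ => ?_
    simp only [ite_and]
    rw [Finset.sum_eq_single i, Finset.sum_comm]
    · refine Finset.sum_congr rfl fun l _ => Finset.sum_congr rfl fun k _ => ?_
      simp only [if_true]
      split_ifs with hlk
      · have e1 : A i l * A' i k = -(A' i k * A i l) := h.annihilate_create fun H => hlk.ne H.2
        calc _ = A' i k * A' i l * (A i l * A i k) := by simp [H]
          _ = -(A' i l * (A' i k * A i l) * A i k) := by rw [h.anti' i k]; noncomm_ring
          _ = A' i l * (A i l * A' i k) * A i k := by rw [e1]; noncomm_ring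
          _ = _ := by simp only [num]; noncomm_ring
      · rfl
    · intro j _ hj
      simp [hj.symm]
    · simp
  have hn : (∑ i, ∑ j, ∑ k, ∑ l, if l = i ∧ i < j ∧ j < k then num A A' i k else 0) =
      ∑ i, ∑ j, ∑ k, if i < j ∧ j < k then num A A' i k else 0 := by
    refine Finset.sum_congr rfl fun i _ => Finset.sum_congr rfl fun j _ =>
      Finset.sum_congr rfl fun k _ => ?_
    rw [Finset.sum_eq_single i]
    · simp
    · intro l _ hl
      simp [hl]
    · simp
  rw [e]
  simp only [h.bd_term, Finset.sum_add_distrib, Finset.sum_sub_distrib]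
  rw [hs1, hs2, sub_eq_iff_eq_add] at hs
  simp only [H, G] at hs g t1 t2 t3
  rw [hn, t1, t2, t3, ← g, hs]
  abel

end Laplacian

section Fock

variable {n : ℕ}

lemma key_injective : Function.Injective (key : P n → ℕ) := by
  rintro ⟨⟨a, b⟩, hab⟩ ⟨⟨c, d⟩, hcd⟩ h
  simp only [key] at h
  have hn : 0 < n := a.pos
  have h1 := congrArg (· / n) h
  have h2 := congrArg (· % n) h
  simp only [mul_comm _ n, Nat.mul_add_div hn, Nat.div_eq_of_lt b.2, Nat.div_eq_of_lt d.2,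
    Nat.mul_add_mod, Nat.mod_eq_of_lt b.2, Nat.mod_eq_of_lt d.2, add_zero] at h1 h2
  simp [Fin.ext_iff, h1, h2]

/-- The sign of moving past one factor. -/
def step (b a : P n) : ℤ := if key b < key a then -1 else 1

lemma step_self (a : P n) : step a a = 1 := by simp [step]

lemma step_sq (a b : P n) : step a b * step a b = 1 := by
  unfold step; split_ifs <;> simp

lemma step_comm {a b : P n} (h : a ≠ b) : step a b = -step b a := by
  have := key_injective.ne h
  unfold step
  rcases lt_or_gt_of_ne this with h | h <;> simp [h, h.not_gt]

/-- The sign of moving `e_a` to the front of `e_M`. -/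
def sgn (M : Finset (P n)) (a : P n) : ℤ := ∏ b ∈ M, step b a

lemma neg_one_pow_pos (M : Finset (P n)) (a : P n) : (-1 : ℤ) ^ pos M a = sgn M a := by
  simp [sgn, step, pos, Finset.prod_ite]

lemma sgn_sq (M : Finset (P n)) (a : P n) : sgn M a * sgn M a = 1 := by
  rw [sgn, ← Finset.prod_mul_distrib]
  exact Finset.prod_eq_one fun b _ => step_sq b a

lemma sgn_insert {M : Finset (P n)} {b : P n} (h : b ∉ M) (a : P n) :
    sgn (insert b M) a = step b a * sgn M a := Finset.prod_insert h

lemma sgn_erase {M : Finset (P n)} {b : P n} (h : b ∈ M) (a : P n) :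
    sgn (M.erase b) a = step b a * sgn M a := by
  rw [sgn, sgn, ← Finset.mul_prod_erase M _ h, ← mul_assoc, step_sq, one_mul]

/-- The underlying ungraded module of `Λ^* nil_n`. -/
abbrev Fock (n : ℕ) : Type := Finset (P n) →₀ ℤ

/-- The basis wedge `e_M`. -/
noncomputable def wedge (M : Finset (P n)) : Fock n := Finsupp.single M 1

/-- Contraction with the dual of `e_a`. -/
noncomputable def lower (a : P n) : Module.End ℤ (Fock n) :=
  Finsupp.linearCombination ℤ fun M => if a ∈ M then sgn M a • wedge (M.erase a) else 0

/-- Exterior multiplication by `e_a`. -/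
noncomputable def raise (a : P n) : Module.End ℤ (Fock n) :=
  Finsupp.linearCombination ℤ fun M => if a ∈ M then 0 else sgn M a • wedge (insert a M)

lemma lower_wedge (a : P n) (M : Finset (P n)) :
    lower a (wedge M) = if a ∈ M then sgn M a • wedge (M.erase a) else 0 := by
  simp [lower, wedge]

lemma raise_wedge (a : P n) (M : Finset (P n)) :
    raise a (wedge M) = if a ∈ M then 0 else sgn M a • wedge (insert a M) := by
  simp [raise, wedge]

lemma end_ext {f g : Fock n →ₗ[ℤ] Fock n} (h : ∀ M, f (wedge M) = g (wedge M)) : f = g :=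
  Finsupp.lhom_ext' fun M => LinearMap.ext_ring (h M)

lemma lower_mul_lower (a b : P n) : lower a * lower b = -(lower b * lower a) := by
  refine end_ext fun M => ?_
  simp only [Module.End.mul_apply, LinearMap.neg_apply, lower_wedge]
  by_cases hab : a = b
  · subst hab
    by_cases ha : a ∈ M <;> simp [ha, lower_wedge]
  by_cases ha : a ∈ M <;> by_cases hb : b ∈ M <;>
    simp only [ha, hb, if_true, if_false, map_zero, map_smul, lower_wedge, Finset.mem_erase,
      ne_eq, hab, Ne.symm hab, not_false_eq_true, and_self, and_false, smul_zero, neg_zero]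
  rw [sgn_erase hb, sgn_erase ha, Finset.erase_right_comm, step_comm hab, smul_smul, smul_smul,
    ← neg_smul]
  congr 1
  ring

lemma raise_mul_raise (a b : P n) : raise a * raise b = -(raise b * raise a) := by
  refine end_ext fun M => ?_
  simp only [Module.End.mul_apply, LinearMap.neg_apply, raise_wedge]
  by_cases hab : a = b
  · subst hab
    by_cases ha : a ∈ M <;> simp [ha, raise_wedge]
  by_cases ha : a ∈ M <;> by_cases hb : b ∈ M <;>
    simp only [ha, hb, if_true, if_false, map_zero, map_smul, raise_wedge, Finset.mem_insert,
      hab, Ne.symm hab, or_false, or_true, smul_zero, neg_zero]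
  rw [sgn_insert hb, sgn_insert ha, Finset.insert_comm, step_comm hab, smul_smul, smul_smul,
    ← neg_smul]
  congr 1
  ring

lemma lower_mul_raise (a b : P n) :
    lower a * raise b = (if a = b then 1 else 0) - raise b * lower a := by
  refine end_ext fun M => ?_
  simp only [Module.End.mul_apply, LinearMap.sub_apply, lower_wedge, raise_wedge]
  by_cases hab : a = b
  · subst hab
    by_cases ha : a ∈ M
    · simp [ha, raise_wedge, sgn_erase ha, step_self, smul_smul, sgn_sq, Finset.insert_erase ha]
    · simp [ha, lower_wedge, sgn_insert ha, step_self, smul_smul, sgn_sq]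
  by_cases ha : a ∈ M <;> by_cases hb : b ∈ M <;>
    simp only [ha, hb, if_true, if_false, map_zero, map_smul, raise_wedge, lower_wedge,
      Finset.mem_insert, Finset.mem_erase, ne_eq, not_false_eq_true, and_true, and_false,
      hab, Ne.symm hab, or_false, or_true, smul_zero, LinearMap.zero_apply, sub_self]
  rw [sgn_insert hb, sgn_erase ha, Finset.erase_insert_of_ne (Ne.symm hab), step_comm hab,
    smul_smul, smul_smul, zero_sub, ← neg_smul]
  congr 1
  ring

/-- `lower` indexed by arbitrary pairs. -/
noncomputable def ann (i j : Fin n) : Module.End ℤ (Fock n) :=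
  if h : i < j then lower ⟨(i, j), h⟩ else 0

/-- `raise` indexed by arbitrary pairs. -/
noncomputable def cre (i j : Fin n) : Module.End ℤ (Fock n) :=
  if h : i < j then raise ⟨(i, j), h⟩ else 0

lemma car : CAR (ann (n := n)) cre where
  zero i j h := by simp [ann, h]
  zero' i j h := by simp [cre, h]
  anti i j k l := by
    unfold ann
    split_ifs <;> simp [lower_mul_lower ⟨(i, j), _⟩]
  anti' i j k l := by
    unfold cre
    split_ifs <;> simp [raise_mul_raise ⟨(i, j), _⟩]
  mixed i j k l := by
    unfold ann cre
    by_cases h1 : i < j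
    · by_cases h2 : k < l
      · simp [h1, h2, lower_mul_raise]
      · have : ¬ (i = k ∧ j = l) := by rintro ⟨rfl, rfl⟩; exact h2 h1
        simp [h1, h2, this]
    · simp [h1]

lemma lower_adj (a : P n) : IsAdj (lower a) (raise a) := by
  refine IsAdj.of_single fun M N => ?_
  change lower a (wedge M) N = raise a (wedge N) M
  rw [lower_wedge, raise_wedge]
  by_cases hM : a ∈ M <;> by_cases hN : a ∈ N
  · have : M.erase a ≠ N := fun h => Finset.notMem_erase a M (h ▸ hN)
    simp [hM, hN, wedge, this]
  · by_cases h : M.erase a = N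
    · subst h
      simp [hM, wedge, Finset.insert_erase hM, sgn_erase hM, step_self]
    · have h' : insert a N ≠ M := fun e => h (by rw [← e, Finset.erase_insert hN])
      simp [hM, hN, wedge, h, h']
  · simp [hM, hN]
  · have : insert a N ≠ M := fun h => hM (h ▸ Finset.mem_insert_self a N)
    simp [hM, hN, wedge, this]

lemma ann_adj (i j : Fin n) : IsAdj (ann i j) (cre i j) := by
  unfold ann cre
  split_ifs
  · exact lower_adj _
  · intro x y
    simp [dot]

/-- The boundary operator on the Fock space. -/
noncomputable def bdF (n : ℕ) : Module.End ℤ (Fock n) := bd ann cre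

/-- The transposed boundary operator on the Fock space. -/
noncomputable def cobdF (n : ℕ) : Module.End ℤ (Fock n) := cobd ann cre

lemma bdF_adj : IsAdj (bdF n) (cobdF n) := by
  refine IsAdj.sum fun i _ => IsAdj.sum fun j _ => IsAdj.sum fun k _ => ?_
  rw [mul_assoc (cre j k)]
  exact ((ann_adj i k).symm.mul (ann_adj i j)).mul (ann_adj j k)

end Fock

section Weights

variable {n : ℕ}

lemma sum_pairs {M : Type*} [AddCommMonoid M] (f : P n → M) :
    ∑ p, f p = ∑ i, ∑ j, if h : i < j then f ⟨(i, j), h⟩ else 0 := by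
  rw [← Fintype.sum_prod_type' (f := fun i j : Fin n => if h : i < j then f ⟨(i, j), h⟩ else 0)]
  refine Fintype.sum_of_injective Subtype.val Subtype.val_injective _ _ ?_ ?_
  · rintro ⟨i, j⟩ h
    have : ¬ i < j := fun hij => h ⟨⟨(i, j), hij⟩, rfl⟩
    simp [this]
  · rintro ⟨⟨i, j⟩, h⟩
    simp [show i < j from h]

/-- Indicator of `(i, j) ∈ M`. -/
def ind (M : Finset (P n)) (i j : Fin n) : ℤ :=
  if h : i < j then if ⟨(i, j), h⟩ ∈ M then 1 else 0 else 0

lemma ind_of_not_lt (M : Finset (P n)) {i j : Fin n} (h : ¬ i < j) : ind M i j = 0 := by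
  simp [ind, h]

lemma ind_zero_or_one (M : Finset (P n)) (i j : Fin n) : ind M i j = 0 ∨ ind M i j = 1 := by
  unfold ind
  split_ifs <;> simp

lemma ind_sq (M : Finset (P n)) (i j : Fin n) : ind M i j * ind M i j = ind M i j := by
  rcases ind_zero_or_one M i j with h | h <;> simp [h]

lemma card_filter_eq (M : Finset (P n)) (q : P n → Prop) [DecidablePred q] :
    ((M.filter q).card : ℤ) =
      ∑ i, ∑ j, if h : i < j then if q ⟨(i, j), h⟩ then ind M i j else 0 else 0 := by
  have : ((M.filter q).card : ℤ) = ∑ p, if q p then if p ∈ M then 1 else 0 else 0 := by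
    rw [Finset.card_filter, Nat.cast_sum, ← Finset.sum_subset (Finset.subset_univ M)]
    · exact Finset.sum_congr rfl fun p hp => by simp [hp]
    · intro p _ hp
      simp [hp]
  rw [this, sum_pairs]
  refine Finset.sum_congr rfl fun i _ => Finset.sum_congr rfl fun j _ => ?_
  by_cases h : i < j <;> simp [h, ind]

lemma card_filter_fst (M : Finset (P n)) (i : Fin n) :
    ((M.filter fun p => p.1.1 = i).card : ℤ) = ∑ k, ind M i k := by
  rw [card_filter_eq, Finset.sum_eq_single i]
  · refine Finset.sum_congr rfl fun k _ => ?_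
    by_cases h : i < k <;> simp [h, ind_of_not_lt]
  · intro b _ hb
    simp [hb]
  · simp

lemma card_filter_snd (M : Finset (P n)) (i : Fin n) :
    ((M.filter fun p => p.1.2 = i).card : ℤ) = ∑ k, ind M k i := by
  rw [card_filter_eq]
  refine Finset.sum_congr rfl fun k _ => ?_
  rw [Finset.sum_eq_single i]
  · by_cases h : k < i <;> simp [h, ind_of_not_lt]
  · intro b _ hb
    simp [hb]
  · simp

lemma wt_eq (M : Finset (P n)) (i : Fin n) :
    wt M i = (i.1 + 1) - ∑ k, ind M k i + ∑ k, ind M i k := by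
  rw [← card_filter_fst, ← card_filter_snd, wt]

/-- The number of cyclic triples of the tournament encoded by `M`. -/
def cyc (M : Finset (P n)) : ℤ :=
  (∑ i, ∑ j, ∑ k, if i < j ∧ j < k then ind M i k else 0)
    + (∑ i, ∑ j, ∑ k, ind M i j * ind M j k)
    - (∑ i, ∑ j, ∑ k, if i < j then ind M j k * ind M i k else 0)
    - (∑ i, ∑ j, ∑ k, if j < k then ind M i j * ind M i k else 0)

lemma num_wedge (i j : Fin n) (M : Finset (P n)) :
    num ann cre i j (wedge M) = ind M i j • wedge M := by
  unfold num ann cre ind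
  by_cases h : i < j
  · by_cases hM : (⟨(i, j), h⟩ : P n) ∈ M
    · simp [h, hM, lower_wedge, raise_wedge, sgn_erase hM, step_self, smul_smul, sgn_sq,
        Finset.insert_erase hM]
    · simp [h, hM, lower_wedge]
  · simp [h]

lemma laplacian_wedge (M : Finset (P n)) :
    bdF n (cobdF n (wedge M)) + cobdF n (bdF n (wedge M)) = cyc M • wedge M := by
  have h := LinearMap.congr_fun (car (n := n)).laplacian (wedge M)
  have hite : ∀ (q : Prop) [Decidable q] (f : Module.End ℤ (Fock n)),
      (if q then f else 0) (wedge M) = if q then f (wedge M) else 0 := by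
    intro q _ f
    split_ifs <;> rfl
  simp only [LinearMap.add_apply, LinearMap.sub_apply, LinearMap.sum_apply, Module.End.mul_apply,
    num_wedge, map_smul, hite, smul_smul] at h
  rw [bdF, cobdF, h, cyc]
  simp only [sub_smul, add_smul, Finset.sum_smul, ite_smul, zero_smul, mul_comm]

lemma two_mul_sum_lt (f : Fin n → ℤ) (hf : ∀ i, f i * f i = f i) :
    2 * ∑ i, ∑ j, (if i < j then f i * f j else 0) = (∑ i, f i) ^ 2 - ∑ i, f i := by
  have h : (∑ i, f i) ^ 2 = ∑ i, ∑ j, ((if i < j then f i * f j else 0)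
      + (if j < i then f i * f j else 0) + if i = j then f i else 0) := by
    rw [sq, Finset.sum_mul_sum]
    refine Finset.sum_congr rfl fun i _ => Finset.sum_congr rfl fun j _ => ?_
    rcases lt_trichotomy i j with h | rfl | h
    · simp [h, h.not_gt, h.ne]
    · simp [hf]
    · simp [h, h.not_gt, h.ne']
  have h2 : (∑ i, ∑ j, if j < i then f i * f j else 0) =
      ∑ i, ∑ j, if i < j then f i * f j else 0 := by
    rw [Finset.sum_comm]
    simp only [mul_comm]
  rw [h]
  simp only [Finset.sum_add_distrib, h2]
  simp
  ring

lemma two_mul_cyc (M : Finset (P n)) :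
    2 * cyc M = ∑ i : Fin n, (((i.1 : ℤ) + 1) ^ 2 - wt M i ^ 2) := by
  set O : Fin n → ℤ := fun i => ∑ k, ind M i k with hO
  set I : Fin n → ℤ := fun i => ∑ k, ind M k i with hI
  have h1 : (∑ i, ∑ j, ∑ k, if i < j ∧ j < k then ind M i k else 0) =
      ∑ i : Fin n, ∑ k : Fin n, ((k.1 : ℤ) - i.1 - 1) * ind M i k := by
    refine Finset.sum_congr rfl fun i _ => ?_
    rw [Finset.sum_comm]
    refine Finset.sum_congr rfl fun k _ => ?_
    by_cases hik : i < k
    · rw [← Finset.sum_filter, Finset.sum_const, nsmul_eq_mul]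
      congr 1
      have : Finset.univ.filter (fun j => i < j ∧ j < k) = Finset.Ioo i k := by ext; simp
      rw [this, Fin.card_Ioo]
      have : i.1 < k.1 := hik
      omega
    · simp [ind_of_not_lt M hik]
  have h2 : (∑ i, ∑ j, ∑ k, ind M i j * ind M j k) = ∑ j, I j * O j := by
    rw [Finset.sum_comm]
    refine Finset.sum_congr rfl fun j _ => ?_
    rw [hI, hO, Finset.sum_mul_sum]
  have h3 : 2 * (∑ i, ∑ j, ∑ k, if i < j then ind M j k * ind M i k else 0) =
      ∑ k, (I k ^ 2 - I k) := by
    have : (∑ i, ∑ j, ∑ k, if i < j then ind M j k * ind M i k else 0) =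
        ∑ k, ∑ i, ∑ j, if i < j then ind M i k * ind M j k else 0 := by
      rw [Finset.sum_congr rfl fun i _ => Finset.sum_comm, Finset.sum_comm]
      simp only [mul_comm]
    rw [this, Finset.mul_sum]
    exact Finset.sum_congr rfl fun k _ => two_mul_sum_lt _ fun i => ind_sq M i k
  have h4 : 2 * (∑ i, ∑ j, ∑ k, if j < k then ind M i j * ind M i k else 0) =
      ∑ i, (O i ^ 2 - O i) := by
    rw [Finset.mul_sum]
    exact Finset.sum_congr rfl fun i _ => two_mul_sum_lt _ fun j => ind_sq M i j
  have h5 : (∑ i : Fin n, ∑ k : Fin n, ((k.1 : ℤ) - i.1 - 1) * ind M i k) =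
      (∑ i : Fin n, (i.1 : ℤ) * I i) - (∑ i : Fin n, (i.1 : ℤ) * O i) - ∑ i, O i := by
    simp only [hI, hO, Finset.mul_sum, sub_mul, one_mul, Finset.sum_sub_distrib]
    rw [Finset.sum_comm (f := fun i k : Fin n => (k.1 : ℤ) * ind M i k)]
  have h6 : ∑ i, I i = ∑ i, O i := Finset.sum_comm
  have h7 : ∑ i : Fin n, (((i.1 : ℤ) + 1) ^ 2 - wt M i ^ 2) =
      2 * (∑ i : Fin n, (i.1 : ℤ) * I i) - 2 * (∑ i : Fin n, (i.1 : ℤ) * O i)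
        + 2 * ∑ i, I i - 2 * ∑ i, O i - ∑ i, I i ^ 2 - ∑ i, O i ^ 2 + 2 * ∑ i, I i * O i := by
    simp only [Finset.mul_sum, ← Finset.sum_add_distrib, ← Finset.sum_sub_distrib]
    refine Finset.sum_congr rfl fun i _ => ?_
    rw [wt_eq]
    change _ - ((i.1 : ℤ) + 1 - I i + O i) ^ 2 = _
    ring
  rw [Finset.sum_sub_distrib] at h3 h4
  rw [h7, cyc, h1, h2, h5]
  linarith

lemma cyc_eq (M : Finset (P n)) : cyc M = ∑ i, ∑ j, ∑ k, if i < j ∧ j < k then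
    ind M i j * ind M j k * (1 - ind M i k) + ind M i k * (1 - ind M i j) * (1 - ind M j k)
    else 0 := by
  simp only [cyc, ← Finset.sum_add_distrib, ← Finset.sum_sub_distrib]
  refine Finset.sum_congr rfl fun i _ => Finset.sum_congr rfl fun j _ =>
    Finset.sum_congr rfl fun k _ => ?_
  by_cases hij : i < j <;> by_cases hjk : j < k <;>
    simp only [hij, hjk, and_self, and_false, false_and, if_true, if_false,
      ind_of_not_lt M, not_false_eq_true] <;> ring

/-- `beat M u v` is `1` if the tournament encoded by `M` has an arrow from `u` to `v`. -/
def beat (M : Finset (P n)) (u v : Fin n) : ℤ :=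
  if u < v then ind M u v else if v < u then 1 - ind M v u else 0

lemma beat_zero_or_one (M : Finset (P n)) (u v : Fin n) : beat M u v = 0 ∨ beat M u v = 1 := by
  unfold beat
  split_ifs
  · exact ind_zero_or_one M u v
  · rcases ind_zero_or_one M v u with h | h <;> simp [h]
  · simp

lemma beat_add_beat (M : Finset (P n)) {u v : Fin n} (h : u ≠ v) : beat M u v + beat M v u = 1 := by
  unfold beat
  rcases lt_or_gt_of_ne h with h | h <;> simp [h, h.not_gt]

lemma wt_eq_beat (M : Finset (P n)) (u : Fin n) : wt M u = 1 + ∑ v, beat M u v := by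
  have h : ∀ v, beat M u v = (if v < u then 1 else 0) - ind M v u + ind M u v := fun v => by
    unfold beat
    rcases lt_trichotomy u v with h | rfl | h
    · simp [h, h.not_gt, ind_of_not_lt]
    · simp [ind_of_not_lt]
    · simp [h, h.not_gt, ind_of_not_lt]
  have hc : (∑ v : Fin n, if v < u then (1 : ℤ) else 0) = u.1 := by
    rw [← Finset.sum_filter, Finset.sum_const]
    have : Finset.univ.filter (fun v => v < u) = Finset.Iio u := by ext; simp
    simp [this]
  rw [wt_eq]
  simp only [h, Finset.sum_add_distrib, Finset.sum_sub_distrib, hc]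
  ring

lemma exists_cyclic (M : Finset (P n)) {u v : Fin n} (huv : u ≠ v) (h : wt M u = wt M v) :
    ∃ a b c, beat M a b = 1 ∧ beat M b c = 1 ∧ beat M c a = 1 := by
  wlog hb : beat M u v = 1 generalizing u v
  · refine this huv.symm h.symm ?_
    have := beat_add_beat M huv
    rcases beat_zero_or_one M u v with h0 | h0
    · linarith
    · exact absurd h0 hb
  by_contra! hc
  have hvu : beat M v u = 0 := by linarith [beat_add_beat M huv]
  have hself : beat M v v = 0 := by simp [beat]
  refine absurd h (ne_of_gt ?_)
  rw [wt_eq_beat, wt_eq_beat, add_lt_add_iff_left]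
  refine Finset.sum_lt_sum (fun x _ => ?_) ⟨v, Finset.mem_univ v, by rw [hb, hself]; norm_num⟩
  rcases beat_zero_or_one M v x with h0 | h0
  · rw [h0]
    rcases beat_zero_or_one M u x with h1 | h1 <;> simp [h1]
  · have hxu : u ≠ x := by rintro rfl; rw [hvu] at h0; exact zero_ne_one h0
    have h1 : beat M x u = 0 :=
      (beat_zero_or_one M x u).resolve_right fun h1 => hc u v x hb h0 h1
    linarith [beat_add_beat M hxu]

lemma cyc_pos (M : Finset (P n)) {u v : Fin n} (huv : u ≠ v) (h : wt M u = wt M v) : 0 < cyc M := by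
  have hnonneg : ∀ i j k : Fin n, 0 ≤ if i < j ∧ j < k then
      ind M i j * ind M j k * (1 - ind M i k) + ind M i k * (1 - ind M i j) * (1 - ind M j k)
      else 0 := fun i j k => by
    rcases ind_zero_or_one M i j with h1 | h1 <;> rcases ind_zero_or_one M j k with h2 | h2 <;>
      rcases ind_zero_or_one M i k with h3 | h3 <;> simp only [h1, h2, h3] <;> split_ifs <;> simp
  have hpos : ∀ i j k : Fin n, i < j → j < k →
      (ind M i j = 1 ∧ ind M j k = 1 ∧ ind M i k = 0 ∨
        ind M i j = 0 ∧ ind M j k = 0 ∧ ind M i k = 1) → 0 < cyc M := by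
    intro i j k hij hjk hT
    rw [cyc_eq]
    refine Finset.sum_pos' (fun i _ => Finset.sum_nonneg fun j _ => Finset.sum_nonneg fun k _ =>
      hnonneg i j k) ⟨i, Finset.mem_univ i, ?_⟩
    refine Finset.sum_pos' (fun j _ => Finset.sum_nonneg fun k _ => hnonneg i j k)
      ⟨j, Finset.mem_univ j, ?_⟩
    refine Finset.sum_pos' (fun k _ => hnonneg i j k) ⟨k, Finset.mem_univ k, ?_⟩
    rcases hT with ⟨h1, h2, h3⟩ | ⟨h1, h2, h3⟩ <;> simp [h1, h2, h3, hij, hjk]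
  have hcyc : ∀ a b c : Fin n, a < b → a < c → beat M a b = 1 → beat M b c = 1 →
      beat M c a = 1 → 0 < cyc M := by
    intro a b c hab hac h1 h2 h3
    simp only [beat, hab, hac, hac.not_gt, if_true, if_false] at h1 h2 h3
    rcases lt_trichotomy b c with hbc | rfl | hbc
    · simp only [hbc, if_true] at h2
      exact hpos a b c hab hbc (Or.inl ⟨h1, h2, by linarith⟩)
    · simp at h2
    · simp only [hbc, hbc.not_gt, if_true, if_false] at h2
      exact hpos a c b hac hbc (Or.inr ⟨by linarith, by linarith, h1⟩)
  obtain ⟨a, b, c, h1, h2, h3⟩ := exists_cyclic M huv h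
  have hne : ∀ x y, beat M x y = 1 → x ≠ y := by
    rintro x _ hx rfl
    simp [beat] at hx
  rcases lt_or_gt_of_ne (hne a b h1) with hab | hab
  · rcases lt_or_gt_of_ne (hne c a h3) with hca | hca
    · exact hcyc c a b hca (hca.trans hab) h3 h1 h2
    · exact hcyc a b c hab hca h1 h2 h3
  · rcases lt_or_gt_of_ne (hne b c h2) with hbc | hbc
    · exact hcyc b c a hbc hab h2 h3 h1
    · exact hcyc c a b (hbc.trans hab) hbc h3 h1 h2

end Weights

section Grading

variable {n : ℕ}

lemma CAR.bd_annihilate_eq {R : Type*} [Ring R] {A A' : Fin n → Fin n → R} (h : CAR A A')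
    (a b : Fin n) : bd A A' * A a b = (∑ l, A a l * A l b) - A a b * bd A A' := by
  by_cases hab : a < b
  · rw [← h.bd_annihilate a b hab]
    abel
  · have : ∀ l, A a l * A l b = 0 := fun l => by
      by_cases hal : a < l
      · rw [h.zero l b fun hlb => hab (hal.trans hlb), mul_zero]
      · rw [h.zero a l hal, zero_mul]
    simp [this, h.zero a b hab]

lemma CAR.bd_sq_comm {R : Type*} [Ring R] {A A' : Fin n → Fin n → R} (h : CAR A A')
    (a b : Fin n) : bd A A' * bd A A' * A a b = A a b * (bd A A' * bd A A') := by
  have key : bd A A' * (∑ l, A a l * A l b) = (∑ l, A a l * A l b) * bd A A' := by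
    have e : ∀ l, bd A A' * (A a l * A l b) = (∑ m, A a m * A m l) * A l b
        - A a l * (∑ m, A l m * A m b) + A a l * A l b * bd A A' := fun l => by
      rw [← mul_assoc, h.bd_annihilate_eq, sub_mul, mul_assoc (A a l), h.bd_annihilate_eq]
      noncomm_ring
    simp only [Finset.mul_sum, Finset.sum_mul, e, Finset.sum_add_distrib, Finset.sum_sub_distrib]
    rw [Finset.sum_comm]
    simp [mul_assoc]
  rw [mul_assoc, h.bd_annihilate_eq, mul_sub, key, ← mul_assoc, h.bd_annihilate_eq]
  noncomm_ring

lemma IsAdj.right_unique {ι : Type*} [Fintype ι] {f g g' : Module.End ℤ (ι →₀ ℤ)} (h : IsAdj f g)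
    (h' : IsAdj f g') : g = g' :=
  LinearMap.ext fun y => ext_dot fun x => by rw [← h, ← h']

lemma cobdF_sq_raise (a : P n) : cobdF n * cobdF n * raise a = raise a * (cobdF n * cobdF n) := by
  have hl : lower a * (bdF n * bdF n) = bdF n * bdF n * lower a := by
    have := car.bd_sq_comm a.1.1 a.1.2
    simp only [ann, a.2, dif_pos] at this
    exact this.symm
  have h := (bdF_adj (n := n)).mul bdF_adj
  exact ((lower_adj a).mul h).right_unique (hl ▸ h.mul (lower_adj a))

lemma wedge_insert {M : Finset (P n)} {a : P n} (h : a ∉ M) :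
    wedge (insert a M) = sgn M a • raise a (wedge M) := by
  rw [raise_wedge, if_neg h, smul_smul, sgn_sq, one_smul]

lemma cobdF_cobdF (x : Fock n) : cobdF n (cobdF n x) = 0 := by
  have : cobdF n * cobdF n = 0 := by
    refine end_ext fun M => ?_
    induction M using Finset.induction_on with
    | empty =>
      have : cobdF n (wedge ∅) = 0 := by
        have : ∀ i j, ann i j (wedge (∅ : Finset (P n))) = 0 := fun i j => by
          unfold ann
          split_ifs <;> simp [lower_wedge]
        simp [cobdF, cobd, this]
      simp [this]
    | insert a M h ih =>
      rw [wedge_insert h, map_smul, ← Module.End.mul_apply, cobdF_sq_raise,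
        Module.End.mul_apply, ih]
      simp
  exact LinearMap.congr_fun this x

lemma bdF_bdF (x : Fock n) : bdF n (bdF n x) = 0 := by
  refine ext_dot fun y => ?_
  rw [← bdF_adj.symm, ← bdF_adj.symm, cobdF_cobdF]
  simp [dot]

lemma wt_insert {M : Finset (P n)} {a : P n} (h : a ∉ M) :
    wt (insert a M) = wt M + (Pi.single a.1.1 1 - Pi.single a.1.2 1) := by
  funext i
  simp only [wt, Finset.filter_insert, Pi.add_apply, Pi.sub_apply, Pi.single_apply,
    @eq_comm _ i]
  split_ifs <;> simp [h] <;> ring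

lemma wt_erase {M : Finset (P n)} {a : P n} (h : a ∈ M) :
    wt (M.erase a) = wt M - (Pi.single a.1.1 1 - Pi.single a.1.2 1) := by
  have := wt_insert (Finset.notMem_erase a M)
  rw [Finset.insert_erase h] at this
  rw [this, add_sub_cancel_right]

/-- The degree `k` and weight `w` part of the Fock space. -/
def piece (n : ℕ) (k : ℤ) (w : Fin n → ℤ) : Submodule ℤ (Fock n) :=
  Finsupp.supported ℤ ℤ {M | (M.card : ℤ) = k ∧ wt M = w}

lemma wedge_mem_piece {M : Finset (P n)} {k : ℤ} {w : Fin n → ℤ} (hk : (M.card : ℤ) = k)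
    (hw : wt M = w) : wedge M ∈ piece n k w :=
  Finsupp.single_mem_supported ℤ 1 ⟨hk, hw⟩

lemma map_piece_le {f : Module.End ℤ (Fock n)} {k : ℤ} {w : Fin n → ℤ} {S : Submodule ℤ (Fock n)}
    (h : ∀ M : Finset (P n), (M.card : ℤ) = k → wt M = w → f (wedge M) ∈ S) {x : Fock n}
    (hx : x ∈ piece n k w) : f x ∈ S := by
  have : piece n k w ≤ S.comap f := by
    rw [piece, Finsupp.supported_eq_span_single, Submodule.span_le]
    rintro _ ⟨M, ⟨h1, h2⟩, rfl⟩
    exact h M h1 h2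
  exact this hx

lemma ann_mem_piece (i j : Fin n) {k : ℤ} {w : Fin n → ℤ} {x : Fock n} (hx : x ∈ piece n k w) :
    ann i j x ∈ piece n (k - 1) (w - (Pi.single i 1 - Pi.single j 1)) := by
  refine map_piece_le (fun M hk hw => ?_) hx
  unfold ann
  split_ifs with h
  · rw [lower_wedge]
    split_ifs with hM
    · refine Submodule.smul_mem _ _ (wedge_mem_piece ?_ ?_)
      · rw [← hk, Finset.card_erase_of_mem hM, Nat.cast_sub (Finset.card_pos.2 ⟨_, hM⟩)]
        simp
      · rw [wt_erase hM, hw]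
    · exact zero_mem _
  · exact zero_mem _

lemma cre_mem_piece (i j : Fin n) {k : ℤ} {w : Fin n → ℤ} {x : Fock n} (hx : x ∈ piece n k w) :
    cre i j x ∈ piece n (k + 1) (w + (Pi.single i 1 - Pi.single j 1)) := by
  refine map_piece_le (fun M hk hw => ?_) hx
  unfold cre
  split_ifs with h
  · rw [raise_wedge]
    split_ifs with hM
    · exact zero_mem _
    · refine Submodule.smul_mem _ _ (wedge_mem_piece ?_ ?_)
      · rw [← hk, Finset.card_insert_of_notMem hM]
        simp
      · rw [wt_insert hM, hw]
  · exact zero_mem _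

lemma bdF_mem_piece {k : ℤ} {w : Fin n → ℤ} {x : Fock n} (hx : x ∈ piece n (k + 1) w) :
    bdF n x ∈ piece n k w := by
  simp only [bdF, bd, LinearMap.sum_apply, Module.End.mul_apply]
  refine Submodule.sum_mem _ fun i _ => Submodule.sum_mem _ fun j _ =>
    Submodule.sum_mem _ fun l _ => ?_
  convert cre_mem_piece i l (ann_mem_piece i j (ann_mem_piece j l hx)) using 2
  · ring
  · abel

lemma cobdF_mem_piece {k : ℤ} {w : Fin n → ℤ} {x : Fock n} (hx : x ∈ piece n k w) :
    cobdF n x ∈ piece n (k + 1) w := by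
  simp only [cobdF, cobd, LinearMap.sum_apply, Module.End.mul_apply]
  refine Submodule.sum_mem _ fun i _ => Submodule.sum_mem _ fun j _ =>
    Submodule.sum_mem _ fun l _ => ?_
  convert cre_mem_piece j l (cre_mem_piece i j (ann_mem_piece i l hx)) using 2
  · ring
  · abel

lemma laplacian_piece {k : ℤ} {w : Fin n → ℤ} {c : ℤ}
    (hc : ∀ M : Finset (P n), wt M = w → cyc M = c) {x : Fock n} (hx : x ∈ piece n k w) :
    bdF n (cobdF n x) + cobdF n (bdF n x) = c • x := by
  have := map_piece_le (f := bdF n * cobdF n + cobdF n * bdF n - c • 1) (S := ⊥)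
    (fun M _ hw => ?_) hx
  · simpa [sub_eq_zero] using this
  · simp [laplacian_wedge, hc M hw]

/-- The projection of the Fock space onto `piece n k w`. -/
noncomputable def proj (n : ℕ) (k : ℤ) (w : Fin n → ℤ) : Module.End ℤ (Fock n) :=
  Finsupp.linearCombination ℤ fun M => if (M.card : ℤ) = k ∧ wt M = w then wedge M else 0

lemma proj_wedge (k : ℤ) (w : Fin n → ℤ) (M : Finset (P n)) :
    proj n k w (wedge M) = if (M.card : ℤ) = k ∧ wt M = w then wedge M else 0 := by
  simp [proj, wedge]

lemma proj_of_mem {k : ℤ} {w : Fin n → ℤ} {x : Fock n} (hx : x ∈ piece n k w) :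
    proj n k w x = x := by
  have := map_piece_le (f := proj n k w - 1) (S := ⊥) (fun M hk hw => ?_) hx
  · simpa [sub_eq_zero] using this
  · simp [proj_wedge, hk, hw]

lemma proj_mem (k : ℤ) (w : Fin n → ℤ) (x : Fock n) : proj n k w x ∈ piece n k w := by
  induction x using Finsupp.induction_linear with
  | zero => simp
  | add x y hx hy => rw [map_add]; exact add_mem hx hy
  | single M c =>
    rw [show Finsupp.single M c = c • wedge M by simp [wedge], map_smul, proj_wedge]
    refine Submodule.smul_mem _ _ ?_
    split_ifs with h
    · exact wedge_mem_piece h.1 h.2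
    · exact zero_mem _

lemma proj_adj (k : ℤ) (w : Fin n → ℤ) : IsAdj (proj n k w) (proj n k w) := by
  refine IsAdj.of_single fun M N => ?_
  change proj n k w (wedge M) N = proj n k w (wedge N) M
  by_cases h : M = N
  · rw [h]
  · rw [proj_wedge, proj_wedge]
    split_ifs <;> simp [wedge, h, Ne.symm h]

lemma cobdF_proj (k : ℤ) (w : Fin n → ℤ) :
    cobdF n * proj n k w = proj n (k + 1) w * cobdF n := by
  refine end_ext fun M => ?_
  simp only [Module.End.mul_apply]
  rw [proj_wedge]
  split_ifs with h
  · rw [proj_of_mem (cobdF_mem_piece (wedge_mem_piece h.1 h.2))]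
  · have hM : cobdF n (wedge M) ∈ piece n (M.card + 1) (wt M) :=
      cobdF_mem_piece (wedge_mem_piece rfl rfl)
    rw [map_zero]
    refine (map_piece_le (f := proj n (k + 1) w) (S := ⊥) (fun N h1 h2 => ?_) hM).symm
    rw [proj_wedge, if_neg]
    · exact zero_mem _
    · rintro ⟨h3, h4⟩
      exact h ⟨by linarith, by rw [← h2, h4]⟩

end Grading

section Torsion

variable {n : ℕ}

lemma exists_wt_eq {w : Fin n → ℤ} (hw : Sn n w)
    (hnp : ¬ ∃ π : Equiv.Perm (Fin n), w = permWt n π) : ∃ u v, u ≠ v ∧ w u = w v := by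
  by_contra! h
  let f : Fin n → Fin n := fun i => ⟨(w i - 1).toNat, by have := hw.1 i; omega⟩
  have hf : Function.Injective f := fun i j hij => by
    by_contra hne
    have := h i j hne
    have h1 := hw.1 i
    have h2 := hw.1 j
    simp only [f, Fin.mk.injEq] at hij
    omega
  refine hnp ⟨Equiv.ofBijective f (Finite.injective_iff_bijective.1 hf), funext fun i => ?_⟩
  have := hw.1 i
  simp only [permWt, Equiv.ofBijective_apply, f]
  omega

lemma exists_cyc_eq {w : Fin n → ℤ} (hw : ∃ u v, u ≠ v ∧ w u = w v) :
    ∃ c : ℤ, c ≠ 0 ∧ ∀ M : Finset (P n), wt M = w → cyc M = c := by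
  by_cases h : ∃ M : Finset (P n), wt M = w
  · obtain ⟨M, rfl⟩ := h
    obtain ⟨u, v, huv, h⟩ := hw
    refine ⟨cyc M, (cyc_pos M huv h).ne', fun N hN => ?_⟩
    have h1 := two_mul_cyc M
    have h2 := two_mul_cyc N
    rw [hN] at h2
    linarith
  · exact ⟨1, one_ne_zero, fun M hM => absurd ⟨M, hM⟩ h⟩

lemma mem_of_smul_mem_piece {k c : ℤ} {w : Fin n → ℤ} {x : Fock n} (hc : c ≠ 0)
    (h : c • x ∈ piece n k w) : x ∈ piece n k w := by
  simpa [piece, Finsupp.mem_supported, Finsupp.support_smul_eq hc] using h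

lemma range_mul_proj (f : Module.End ℤ (Fock n)) (k : ℤ) (w : Fin n → ℤ) :
    LinearMap.range (f * proj n k w) = (piece n k w).map f := by
  ext x
  constructor
  · rintro ⟨y, rfl⟩
    exact ⟨_, proj_mem k w y, rfl⟩
  · rintro ⟨y, hy, rfl⟩
    exact ⟨y, by rw [Module.End.mul_apply, proj_of_mem hy]⟩

/-- The homology of a non-permutation weight space agrees with its cohomology one degree up. -/
theorem homology_equiv_cohomology {w : Fin n → ℤ} (hw : ∃ u v, u ≠ v ∧ w u = w v) (m : ℤ) :
    Nonempty
      ((↥(piece n m w ⊓ LinearMap.ker (bdF n)) ⧸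
          ((piece n (m + 1) w).map (bdF n)).comap (piece n m w ⊓ LinearMap.ker (bdF n)).subtype)
        ≃ₗ[ℤ]
        (↥(piece n (m + 1) w ⊓ LinearMap.ker (cobdF n)) ⧸
          ((piece n m w).map (cobdF n)).comap
            (piece n (m + 1) w ⊓ LinearMap.ker (cobdF n)).subtype)) := by
  obtain ⟨c, hc, hcyc⟩ := exists_cyc_eq hw
  have hadj : IsAdj (bdF n * proj n (m + 1) w) (cobdF n * proj n m w) := by
    rw [cobdF_proj]
    exact bdF_adj.mul (proj_adj (m + 1) w)
  rw [← range_mul_proj, ← range_mul_proj]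
  refine saturation_quotient_equiv _ _ hadj _ _ ?_ ?_ ?_ ?_ hc ?_ ?_
  · rintro _ ⟨y, rfl⟩
    exact ⟨bdF_mem_piece (proj_mem _ _ y), bdF_bdF _⟩
  · rintro _ ⟨y, rfl⟩
    exact ⟨cobdF_mem_piece (proj_mem _ _ y), cobdF_cobdF _⟩
  · rintro a y ha ⟨h1, h2⟩
    refine ⟨mem_of_smul_mem_piece ha h1, ?_⟩
    simpa [ha] using h2
  · rintro a y ha ⟨h1, h2⟩
    refine ⟨mem_of_smul_mem_piece ha h1, ?_⟩
    simpa [ha] using h2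
  · rintro y ⟨h1, h2⟩
    rw [range_mul_proj]
    refine ⟨cobdF n y, cobdF_mem_piece h1, ?_⟩
    rw [← laplacian_piece hcyc h1, LinearMap.mem_ker.1 h2, map_zero, add_zero]
  · rintro y ⟨h1, h2⟩
    rw [range_mul_proj]
    refine ⟨bdF n y, bdF_mem_piece h1, ?_⟩
    rw [← laplacian_piece hcyc h1, LinearMap.mem_ker.1 h2, map_zero, zero_add]

end Torsion

section Reversal

variable {n : ℕ}

lemma rev_rev (i : Fin n) : rev (rev i) = i := by
  ext
  simp only [rev]
  omega

lemma rev_lt_rev {i j : Fin n} : rev i < rev j ↔ j < i := by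
  simp only [rev, Fin.lt_def]
  omega

/-- Index reversal as a permutation. -/
def revPerm (n : ℕ) : Equiv.Perm (Fin n) := ⟨rev, rev, rev_rev, rev_rev⟩

/-- Reflection of pairs in the antidiagonal. -/
def flip (n : ℕ) : Equiv.Perm (P n) where
  toFun p := ⟨(rev p.1.2, rev p.1.1), rev_lt_rev.2 p.2⟩
  invFun p := ⟨(rev p.1.2, rev p.1.1), rev_lt_rev.2 p.2⟩
  left_inv p := by simp [rev_rev]
  right_inv p := by simp [rev_rev]

/-- The automorphism `e_M ↦ ε(M) e_{φ(M)}` of the Fock space. -/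
noncomputable def signedPerm (φ : Equiv.Perm (Finset (P n))) (ε : Finset (P n) → ℤ)
    (hε : ∀ M, ε M * ε M = 1) : Fock n ≃ₗ[ℤ] Fock n :=
  LinearEquiv.ofLinearMap
    (Finsupp.linearCombination ℤ fun M => ε M • wedge (φ M))
    (Finsupp.linearCombination ℤ fun M => ε (φ.symm M) • wedge (φ.symm M))
    (end_ext fun M => by simp [wedge, hε])
    (end_ext fun M => by simp [wedge, hε])

lemma signedPerm_wedge (φ : Equiv.Perm (Finset (P n))) (ε : Finset (P n) → ℤ)
    (hε : ∀ M, ε M * ε M = 1) (M : Finset (P n)) :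
    signedPerm φ ε hε (wedge M) = ε M • wedge (φ M) := by
  simp [signedPerm, wedge]

/-- The sign of Poincaré duality on `e_M`. -/
def starSign (M : Finset (P n)) : ℤ := ∏ a ∈ M, sgn Finset.univ a

lemma starSign_sq (M : Finset (P n)) : starSign M * starSign M = 1 := by
  rw [starSign, ← Finset.prod_mul_distrib]
  exact Finset.prod_eq_one fun a _ => sgn_sq _ a

/-- Poincaré duality on the Fock space. -/
noncomputable def star (n : ℕ) : Fock n ≃ₗ[ℤ] Fock n :=
  signedPerm (compl_involutive.toPerm _) starSign starSign_sq

lemma star_wedge (M : Finset (P n)) : star n (wedge M) = starSign M • wedge Mᶜ :=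
  signedPerm_wedge ..

lemma sgn_mul_sgn_compl (M : Finset (P n)) (a : P n) : sgn M a * sgn Mᶜ a = sgn Finset.univ a :=
  Finset.prod_mul_prod_compl M _

lemma star_raise (a : P n) (x : Fock n) : star n (raise a x) = lower a (star n x) := by
  refine LinearMap.congr_fun (f := (star n).toLinearMap ∘ₗ raise a)
    (g := lower a ∘ₗ (star n).toLinearMap) (end_ext fun M => ?_) x
  simp only [LinearMap.comp_apply, LinearEquiv.coe_coe, star_wedge, raise_wedge, map_smul,
    lower_wedge, Finset.mem_compl]
  by_cases ha : a ∈ M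
  · simp [ha]
  · have h : sgn M a * starSign (insert a M) = starSign M * sgn Mᶜ a := by
      rw [starSign, Finset.prod_insert ha, ← sgn_mul_sgn_compl M, starSign]
      linear_combination (∏ b ∈ M, sgn Finset.univ b) * sgn Mᶜ a * sgn_sq M a
    simp [ha, star_wedge, smul_smul, h]

lemma star_lower (a : P n) (x : Fock n) : star n (lower a x) = raise a (star n x) := by
  refine LinearMap.congr_fun (f := (star n).toLinearMap ∘ₗ lower a)
    (g := raise a ∘ₗ (star n).toLinearMap) (end_ext fun M => ?_) x
  simp only [LinearMap.comp_apply, LinearEquiv.coe_coe, star_wedge, raise_wedge, map_smul,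
    lower_wedge, Finset.mem_compl]
  by_cases ha : a ∈ M
  · have h : sgn M a * starSign (M.erase a) = starSign M * sgn Mᶜ a := by
      rw [starSign, starSign, ← Finset.mul_prod_erase M _ ha, ← sgn_mul_sgn_compl M]
      linear_combination (-(∏ b ∈ M.erase a, sgn Finset.univ b) * sgn M a) * sgn_sq Mᶜ a
    simp [ha, star_wedge, smul_smul, h]
  · simp [ha]

/-- The sign of the reflection on `e_M`. -/
def flipSign (M : Finset (P n)) : ℤ :=
  ∏ a ∈ M, ∏ b ∈ M, if key a < key b then step (flip n b) (flip n a) else 1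

lemma flipSign_sq (M : Finset (P n)) : flipSign M * flipSign M = 1 := by
  simp only [flipSign, ← Finset.prod_mul_distrib]
  refine Finset.prod_eq_one fun a _ => Finset.prod_eq_one fun b _ => ?_
  split_ifs
  · exact step_sq _ _
  · exact one_mul 1

lemma flipSign_insert {M : Finset (P n)} {a : P n} (h : a ∉ M) :
    flipSign (insert a M) = flipSign M * (sgn M a * sgn ((flip n).finsetCongr M) (flip n a)) := by
  have hpair : ∀ b ∈ M, (if key b < key a then step (flip n a) (flip n b) else 1) *
      (if key a < key b then step (flip n b) (flip n a) else 1) =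
        step b a * step (flip n b) (flip n a) := fun b hb => by
    have hab : a ≠ b := by rintro rfl; exact h hb
    rcases lt_or_gt_of_ne (key_injective.ne hab) with hlt | hlt
    · simp [hlt, hlt.not_gt, step]
    · simp only [hlt, hlt.not_gt, if_true, if_false, mul_one]
      rw [step_comm ((flip n).injective.ne hab), show step b a = -1 from if_pos hlt]
      ring
  have hs : sgn ((flip n).finsetCongr M) (flip n a) = ∏ b ∈ M, step (flip n b) (flip n a) := by
    simp [sgn, Finset.prod_map]
  rw [hs, sgn, ← Finset.prod_mul_distrib, ← Finset.prod_congr rfl hpair, flipSign,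
    Finset.prod_insert h, Finset.prod_insert h, Finset.prod_mul_distrib, flipSign]
  simp only [Finset.prod_insert h, Finset.prod_mul_distrib, lt_irrefl, if_false]
  ring

/-- Reflection in the antidiagonal on the Fock space. -/
noncomputable def reflect (n : ℕ) : Fock n ≃ₗ[ℤ] Fock n :=
  signedPerm (flip n).finsetCongr flipSign flipSign_sq

lemma reflect_wedge (M : Finset (P n)) :
    reflect n (wedge M) = flipSign M • wedge ((flip n).finsetCongr M) :=
  signedPerm_wedge ..

lemma flip_mem_finsetCongr {M : Finset (P n)} {a : P n} :
    flip n a ∈ (flip n).finsetCongr M ↔ a ∈ M := by simp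

lemma finsetCongr_insert (M : Finset (P n)) (a : P n) :
    (flip n).finsetCongr (insert a M) = insert (flip n a) ((flip n).finsetCongr M) := by
  simp [Finset.map_insert]

lemma reflect_raise (a : P n) (x : Fock n) :
    reflect n (raise a x) = raise (flip n a) (reflect n x) := by
  refine LinearMap.congr_fun (f := (reflect n).toLinearMap ∘ₗ raise a)
    (g := raise (flip n a) ∘ₗ (reflect n).toLinearMap) (end_ext fun M => ?_) x
  simp only [LinearMap.comp_apply, LinearEquiv.coe_coe, reflect_wedge, raise_wedge, map_smul,
    flip_mem_finsetCongr]
  by_cases ha : a ∈ M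
  · simp [ha]
  · rw [if_neg ha, if_neg ha, map_smul, reflect_wedge, flipSign_insert ha, finsetCongr_insert,
      smul_smul, smul_smul]
    congr 1
    linear_combination flipSign M * sgn ((flip n).finsetCongr M) (flip n a) * sgn_sq M a

lemma reflect_lower (a : P n) (x : Fock n) :
    reflect n (lower a x) = lower (flip n a) (reflect n x) := by
  refine LinearMap.congr_fun (f := (reflect n).toLinearMap ∘ₗ lower a)
    (g := lower (flip n a) ∘ₗ (reflect n).toLinearMap) (end_ext fun M => ?_) x
  simp only [LinearMap.comp_apply, LinearEquiv.coe_coe, reflect_wedge, lower_wedge, map_smul,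
    flip_mem_finsetCongr]
  by_cases ha : a ∈ M
  · obtain ⟨N, hN, rfl⟩ : ∃ N, a ∉ N ∧ insert a N = M :=
      ⟨M.erase a, Finset.notMem_erase a M, Finset.insert_erase ha⟩
    have hN' : flip n a ∉ (flip n).finsetCongr N := by rwa [flip_mem_finsetCongr]
    rw [if_pos ha, if_pos ha, map_smul, Finset.erase_insert hN, reflect_wedge, flipSign_insert hN,
      finsetCongr_insert, Finset.erase_insert hN', sgn_insert hN, sgn_insert hN', step_self,
      step_self, smul_smul, smul_smul]
    congr 1
    linear_combination -flipSign N * sgn N a * sgn_sq ((flip n).finsetCongr N) (flip n a)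
  · simp [ha]

lemma star_ann (i j : Fin n) (x : Fock n) : star n (ann i j x) = cre i j (star n x) := by
  unfold ann cre
  split_ifs
  · exact star_lower _ x
  · simp

lemma star_cre (i j : Fin n) (x : Fock n) : star n (cre i j x) = ann i j (star n x) := by
  unfold ann cre
  split_ifs
  · exact star_raise _ x
  · simp

lemma reflect_ann (i j : Fin n) (x : Fock n) :
    reflect n (ann i j x) = ann (rev j) (rev i) (reflect n x) := by
  unfold ann
  simp only [rev_lt_rev]
  split_ifs
  · exact reflect_lower _ x
  · simp

lemma reflect_cre (i j : Fin n) (x : Fock n) :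
    reflect n (cre i j x) = cre (rev j) (rev i) (reflect n x) := by
  unfold cre
  simp only [rev_lt_rev]
  split_ifs
  · exact reflect_raise _ x
  · simp

lemma CAR.dual_summand {R : Type*} [Ring R] {A A' : Fin n → Fin n → R} (h : CAR A A')
    (i j k : Fin n) : A i k * A' i j * A' j k = -(A' j k * A' i j * A i k) := by
  by_cases hij : i < j
  · by_cases hjk : j < k
    · rw [h.annihilate_create fun H => hjk.ne' H.2, neg_mul, mul_assoc,
        h.annihilate_create fun H => hij.ne H.1, mul_neg, neg_neg, ← mul_assoc, h.anti' j k,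
        neg_mul, neg_neg]
    · simp [h.zero' j k hjk]
  · simp [h.zero' i j hij]

lemma star_bdF (x : Fock n) : star n (bdF n x) = -cobdF n (star n x) := by
  simp only [bdF, bd, cobdF, cobd, LinearMap.sum_apply, map_sum, Module.End.mul_apply, star_cre,
    star_ann, ← Finset.sum_neg_distrib]
  refine Finset.sum_congr rfl fun i _ => Finset.sum_congr rfl fun j _ =>
    Finset.sum_congr rfl fun k _ => ?_
  exact LinearMap.congr_fun (car.dual_summand i j k) (star n x)

lemma sum_rev {X : Type*} [AddCommMonoid X] (F : Fin n → Fin n → Fin n → X) :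
    ∑ i, ∑ j, ∑ k, F (rev k) (rev j) (rev i) = ∑ i, ∑ j, ∑ k, F i j k := by
  calc _ = ∑ i, ∑ j, ∑ k, F k j i :=
        Fintype.sum_equiv (revPerm n) _ _ fun i => Fintype.sum_equiv (revPerm n) _ _ fun j =>
          Fintype.sum_equiv (revPerm n) _ _ fun k => rfl
    _ = ∑ i, ∑ k, ∑ j, F k j i := Finset.sum_congr rfl fun i _ => Finset.sum_comm
    _ = ∑ k, ∑ i, ∑ j, F k j i := Finset.sum_comm
    _ = _ := Finset.sum_congr rfl fun k _ => Finset.sum_comm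

lemma reflect_bdF (x : Fock n) : reflect n (bdF n x) = -bdF n (reflect n x) := by
  simp only [bdF, bd, LinearMap.sum_apply, map_sum, Module.End.mul_apply, reflect_cre,
    reflect_ann]
  rw [sum_rev fun i j k => cre i k (ann j k (ann i j (reflect n x)))]
  simp only [← Finset.sum_neg_distrib]
  refine Finset.sum_congr rfl fun i _ => Finset.sum_congr rfl fun j _ =>
    Finset.sum_congr rfl fun k _ => ?_
  rw [← map_neg]
  congr 1
  exact LinearMap.congr_fun (car.anti j k i j) (reflect n x)

/-- The duality between the weight spaces of a weight and its reversal. -/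
noncomputable def dual (n : ℕ) : Fock n ≃ₗ[ℤ] Fock n := reflect n ≪≫ₗ star n

lemma dual_bdF (x : Fock n) : dual n (bdF n x) = cobdF n (dual n x) := by
  simp [dual, reflect_bdF, star_bdF]

lemma ind_compl (M : Finset (P n)) {i j : Fin n} (h : i < j) : ind Mᶜ i j = 1 - ind M i j := by
  by_cases hM : (⟨(i, j), h⟩ : P n) ∈ M <;> simp [ind, h, hM]

lemma ind_flip (M : Finset (P n)) (i j : Fin n) :
    ind ((flip n).finsetCongr M) i j = ind M (rev j) (rev i) := by
  unfold ind
  simp only [rev_lt_rev]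
  by_cases h : i < j
  · have : (⟨(i, j), h⟩ : P n) = flip n ⟨(rev j, rev i), rev_lt_rev.2 h⟩ := by
      simp [flip, rev_rev]
    simp only [h, dif_pos]
    simp only [this, flip_mem_finsetCongr]
  · simp [h]

lemma beat_dual (M : Finset (P n)) (u v : Fin n) :
    beat ((flip n).finsetCongr M)ᶜ u v = beat M (rev u) (rev v) := by
  unfold beat
  rcases lt_trichotomy u v with h | rfl | h
  · simp only [h, h.not_gt, ind_compl, ind_flip, rev_lt_rev, if_true, if_false]
  · simp
  · simp only [h, h.not_gt, ind_compl, ind_flip, rev_lt_rev, if_true, if_false, sub_sub_cancel]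

lemma wt_dual (M : Finset (P n)) (i : Fin n) :
    wt ((flip n).finsetCongr M)ᶜ i = wt M (rev i) := by
  rw [wt_eq_beat, wt_eq_beat]
  simp only [beat_dual]
  exact congrArg (1 + ·) (Fintype.sum_equiv (revPerm n) _ (beat M (rev i)) fun v => rfl)

lemma card_P : Fintype.card (P n) = n.choose 2 := by
  have h := sum_pairs (n := n) fun _ => 1
  rw [Finset.sum_const, Finset.card_univ, smul_eq_mul, mul_one] at h
  rw [h, Finset.sum_comm, Nat.choose_two_right, ← Finset.sum_range_id,
    ← Fin.sum_univ_eq_sum_range fun i => i]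
  refine Finset.sum_congr rfl fun j _ => ?_
  have : Finset.univ.filter (fun i => i < j) = Finset.Iio j := by ext; simp
  simp only [dite_eq_ite, ← Finset.card_filter, this, Fin.card_Iio]

lemma card_dual (M : Finset (P n)) :
    ((((flip n).finsetCongr M)ᶜ.card : ℕ) : ℤ) = n.choose 2 - M.card := by
  rw [Finset.card_compl, Nat.cast_sub (Finset.card_le_univ _), card_P]
  simp

lemma dual_wedge (M : Finset (P n)) :
    ∃ ε : ℤ, ε * ε = 1 ∧ dual n (wedge M) = ε • wedge ((flip n).finsetCongr M)ᶜ := by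
  refine ⟨flipSign M * starSign ((flip n).finsetCongr M), ?_, ?_⟩
  · rw [mul_mul_mul_comm, flipSign_sq, starSign_sq, one_mul]
  · rw [dual, LinearEquiv.trans_apply, reflect_wedge, map_smul, star_wedge, smul_smul]

lemma map_dual_piece (k : ℤ) (w : Fin n → ℤ) :
    (piece n k fun i => w (rev i)).map (dual n : Fock n →ₗ[ℤ] Fock n) =
      piece n (n.choose 2 - k) w := by
  apply le_antisymm
  · rintro _ ⟨x, hx, rfl⟩
    refine map_piece_le (f := (dual n).toLinearMap) (fun M hk hw => ?_) hx
    obtain ⟨ε, -, h⟩ := dual_wedge M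
    rw [LinearEquiv.coe_coe, h]
    refine Submodule.smul_mem _ _ (wedge_mem_piece ?_ ?_)
    · rw [card_dual, hk]
    · funext i
      rw [wt_dual, hw]
      simp [rev_rev]
  · intro x hx
    refine map_piece_le (f := 1) (fun M hk hw => ?_) hx
    obtain ⟨N, rfl⟩ : ∃ N, ((flip n).finsetCongr N)ᶜ = M :=
      ⟨(flip n).finsetCongr.symm Mᶜ, by rw [Equiv.apply_symm_apply, compl_compl]⟩
    obtain ⟨ε, hε, h⟩ := dual_wedge N
    refine ⟨ε • wedge N, Submodule.smul_mem _ _ (wedge_mem_piece ?_ ?_), ?_⟩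
    · rw [card_dual] at hk
      linarith
    · funext i
      rw [← hw, wt_dual, rev_rev]
    · rw [map_smul, LinearEquiv.coe_coe, h, smul_smul, hε, one_smul]
      rfl

lemma quotient_equiv_map {R E F : Type*} [Ring R] [AddCommGroup E] [AddCommGroup F] [Module R E]
    [Module R F] (J : E →ₗ[R] F) (hJ : Function.Injective J) {Z S : Submodule R E}
    {Z' S' : Submodule R F}
    (hZ : Z.map J = Z') (hS : S.map J = S') :
    Nonempty ((Z ⧸ S.comap Z.subtype) ≃ₗ[R] (Z' ⧸ S'.comap Z'.subtype)) := by
  subst hZ hS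
  refine ⟨Submodule.Quotient.equiv _ _ (Submodule.equivMapOfInjective J hJ Z) ?_⟩
  ext ⟨y, hy⟩
  constructor
  · rintro ⟨x, hx, h⟩
    exact ⟨x, hx, congrArg Subtype.val h⟩
  · rintro ⟨x, hx, rfl⟩
    obtain ⟨x', hx', h⟩ := hy
    obtain rfl := hJ h
    exact ⟨⟨x', hx'⟩, hx, rfl⟩

/-- Homology in the reversed weight agrees with cohomology in the complementary degree. -/
theorem homology_equiv_cohomology_rev (k : ℤ) (w : Fin n → ℤ) {m : ℤ}
    (hm : m + 1 = n.choose 2 - k) :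
    Nonempty
      ((↥(piece n k (fun i => w (rev i)) ⊓ LinearMap.ker (bdF n)) ⧸
          ((piece n (k + 1) fun i => w (rev i)).map (bdF n)).comap
            (piece n k (fun i => w (rev i)) ⊓ LinearMap.ker (bdF n)).subtype)
        ≃ₗ[ℤ]
        (↥(piece n (m + 1) w ⊓ LinearMap.ker (cobdF n)) ⧸
          ((piece n m w).map (cobdF n)).comap
            (piece n (m + 1) w ⊓ LinearMap.ker (cobdF n)).subtype)) := by
  have hcomm : (dual n : Fock n →ₗ[ℤ] Fock n) ∘ₗ bdF n = cobdF n ∘ₗ dual n :=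
    LinearMap.ext dual_bdF
  refine quotient_equiv_map (dual n : Fock n →ₗ[ℤ] Fock n) (dual n).injective ?_ ?_
  · rw [Submodule.map_inf _ (dual n).injective, map_dual_piece, hm]
    congr 1
    ext x
    simp only [Submodule.mem_map, LinearMap.mem_ker, LinearEquiv.coe_coe]
    constructor
    · rintro ⟨y, hy, rfl⟩
      rw [← dual_bdF, hy, map_zero]
    · intro hx
      refine ⟨(dual n).symm x, (dual n).injective ?_, (dual n).apply_symm_apply x⟩
      rw [dual_bdF, LinearEquiv.apply_symm_apply, hx, map_zero]
  · rw [← Submodule.map_comp, hcomm, Submodule.map_comp, map_dual_piece,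
      show (n.choose 2 : ℤ) - (k + 1) = m by linarith]

end Reversal

section Comparison

variable {n : ℕ}

lemma key_lt_key {a b : P n} (h : a.1.2 = b.1.1) : key a < key b := by
  have h1 : a.1.1.1 < b.1.1.1 := h ▸ a.2
  have h2 := a.1.2.2
  unfold key
  nlinarith [Nat.mul_le_mul_right n (Nat.succ_le_of_lt h1)]

/-- The product of two composable pairs. -/
def join (a b : P n) (h : a.1.2 = b.1.1) : P n :=
  ⟨(a.1.1, b.1.2), lt_trans a.2 (by rw [h]; exact b.2)⟩

/-- The contribution of one pair of factors to the boundary of `e_M`. -/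
noncomputable def bracketTerm (M : Finset (P n)) (a b : P n) : Fock n :=
  if h : a.1.2 = b.1.1 then raise (join a b h) (lower a (lower b (wedge M))) else 0

lemma bdF_wedge (M : Finset (P n)) : bdF n (wedge M) = ∑ a ∈ M, ∑ b ∈ M, bracketTerm M a b := by
  have hz : ∀ a b, (a ∉ M ∨ b ∉ M) → bracketTerm M a b = 0 := by
    intro a b h
    unfold bracketTerm
    split_ifs with hab
    · by_cases hb : b ∈ M
      · have ha : a ∉ M := h.resolve_right (not_not.2 hb)
        simp [lower_wedge, hb, ha]
      · simp [lower_wedge, hb]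
    · rfl
  have h1 : ∑ a ∈ M, ∑ b ∈ M, bracketTerm M a b = ∑ a, ∑ b, bracketTerm M a b := by
    rw [Finset.sum_subset (Finset.subset_univ M)]
    · exact Finset.sum_congr rfl fun a _ => Finset.sum_subset (Finset.subset_univ M)
        fun b _ hb => hz a b (Or.inr hb)
    · exact fun a _ ha => Finset.sum_eq_zero fun b _ => hz a b (Or.inl ha)
  rw [h1, sum_pairs]
  simp only [bdF, bd, LinearMap.sum_apply, Module.End.mul_apply]
  refine Finset.sum_congr rfl fun i _ => Finset.sum_congr rfl fun j _ => ?_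
  by_cases hij : i < j
  · rw [dif_pos hij, sum_pairs]
    refine ((Finset.sum_eq_single j ?_ ?_).trans ?_).symm
    · intro j' _ hj
      refine Finset.sum_eq_zero fun l _ => ?_
      split_ifs
      · simp [bracketTerm, Ne.symm hj]
      · rfl
    · simp
    · refine Finset.sum_congr rfl fun l _ => ?_
      by_cases hjl : j < l
      · simp [ann, cre, hij, hjl, hij.trans hjl, bracketTerm, join]
      · simp [ann, hjl]
  · simp [ann, hij]

lemma bracketTerm_eq {M : Finset (P n)} {a b : P n} (ha : a ∈ M) (hb : b ∈ M)
    (h : a.1.2 = b.1.1) : bracketTerm M a b =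
      if (insert (join a b h) ((M.erase a).erase b)).card + 1 = M.card then
        ((-1 : ℤ) ^ (pos M a + pos M b +
          pos (insert (join a b h) ((M.erase a).erase b)) (join a b h))) •
            wedge (insert (join a b h) ((M.erase a).erase b))
      else 0 := by
  have hlt := key_lt_key h
  have hab : a ≠ b := by rintro rfl; exact lt_irrefl _ hlt
  have ha' : a ∈ M.erase b := Finset.mem_erase.2 ⟨hab, ha⟩
  have hcard : ((M.erase a).erase b).card + 2 = M.card := by
    rw [Finset.erase_right_comm]
    have h1 := Finset.card_erase_add_one ha'
    have h2 := Finset.card_erase_add_one hb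
    omega
  simp only [bracketTerm, h, dif_pos, lower_wedge, hb, if_true, map_smul, ha', raise_wedge,
    Finset.erase_right_comm (a := b) (b := a), pow_add, neg_one_pow_pos]
  by_cases hc : join a b h ∈ (M.erase a).erase b
  · rw [if_pos hc, Finset.insert_eq_of_mem hc, if_neg (by omega)]
    simp
  · rw [if_neg hc, Finset.card_insert_of_notMem hc, if_pos (by omega), sgn_insert hc, step_self,
      sgn_erase hb, show step b a = 1 from if_neg hlt.not_gt, smul_smul, smul_smul]
    congr 1
    ring

/-- Embedding of the degree `k` chains into the Fock space. -/
noncomputable def toFock (n : ℕ) (k : ℤ) : C n k →ₗ[ℤ] Fock n :=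
  Finsupp.lmapDomain ℤ ℤ Subtype.val

/-- Embedding of the weight summand into the Fock space. -/
noncomputable def toFockW (n : ℕ) (k : ℤ) (w : Fin n → ℤ) : Cw n k w →ₗ[ℤ] Fock n :=
  Finsupp.lmapDomain ℤ ℤ Subtype.val

lemma toFockW_injective (k : ℤ) (w : Fin n → ℤ) : Function.Injective (toFockW n k w) :=
  Finsupp.mapDomain_injective Subtype.val_injective

lemma range_toFockW (k : ℤ) (w : Fin n → ℤ) : LinearMap.range (toFockW n k w) = piece n k w := by
  rw [← Submodule.map_top, ← Finsupp.supported_univ, toFockW, Finsupp.lmapDomain_supported,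
    Set.image_univ]
  exact congrArg _ Subtype.range_coe

lemma toFockW_mem (k : ℤ) (w : Fin n → ℤ) (x : Cw n k w) : toFockW n k w x ∈ piece n k w := by
  rw [← range_toFockW]
  exact ⟨x, rfl⟩

lemma toFock_dAux {k : ℤ} {M : Finset (P n)} (hM : (M.card : ℤ) = k + 1) :
    toFock n k (dAux k M) = bdF n (wedge M) := by
  rw [bdF_wedge, dAux, map_sum]
  refine Finset.sum_congr rfl fun a ha => ?_
  rw [map_sum]
  refine Finset.sum_congr rfl fun b hb => ?_
  by_cases h : a.1.2 = b.1.1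
  · rw [dif_pos h, bracketTerm_eq ha hb h]
    change toFock n k (if h' : ((insert (join a b h) ((M.erase a).erase b)).card : ℤ) = k then _
      else _) = _
    by_cases h' : ((insert (join a b h) ((M.erase a).erase b)).card : ℤ) = k
    · rw [if_pos (by omega), dif_pos h']
      simp [toFock, wedge, join]
    · rw [if_neg (by omega), dif_neg h', map_zero]
  · rw [dif_neg h, bracketTerm, dif_neg h, map_zero]

lemma toFock_d (k : ℤ) (x : C n (k + 1)) : toFock n k (d n k x) = bdF n (toFock n (k + 1) x) := by
  refine LinearMap.congr_fun (f := toFock n k ∘ₗ d n k) (g := bdF n ∘ₗ toFock n (k + 1))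
    (Finsupp.lhom_ext' fun M => LinearMap.ext_ring ?_) x
  have := toFock_dAux M.2
  simpa [d, toFock, wedge] using this

lemma toFock_inclW (k : ℤ) (w : Fin n → ℤ) (x : Cw n k w) :
    toFock n k (inclW n k w x) = toFockW n k w x := by
  simp only [toFock, inclW, toFockW, Finsupp.lmapDomain_apply, ← Finsupp.mapDomain_comp]
  rfl

lemma toFockW_projW (k : ℤ) (w : Fin n → ℤ) (x : C n k) :
    toFockW n k w (projW n k w x) = proj n k w (toFock n k x) := by
  refine LinearMap.congr_fun (f := toFockW n k w ∘ₗ projW n k w) (g := proj n k w ∘ₗ toFock n k)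
    (Finsupp.lhom_ext' fun M => LinearMap.ext_ring ?_) x
  have := proj_wedge k w M.1
  simp only [M.2, true_and] at this
  by_cases h : wt M.1 = w
  · simp_all [projW, toFockW, toFock, wedge]
  · simp_all [projW, toFockW, toFock, wedge]

lemma toFockW_dW (k : ℤ) (w : Fin n → ℤ) (x : Cw n (k + 1) w) :
    toFockW n k w (dW n k w x) = bdF n (toFockW n (k + 1) w x) := by
  simp only [dW, LinearMap.comp_apply]
  rw [toFockW_projW, toFock_d, toFock_inclW, proj_of_mem (bdF_mem_piece (toFockW_mem _ _ x))]

lemma toFockW_castCw (w : Fin n → ℤ) {k l : ℤ} (h : k = l) (x : Cw n k w) :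
    toFockW n l w (castCw n w h x) = toFockW n k w x := by
  subst h
  congr 1
  ext M
  simp [castCw]
  rfl

lemma toFockW_dFromW (k : ℤ) (w : Fin n → ℤ) (x : Cw n k w) :
    toFockW n (k - 1) w (dFromW n k w x) = bdF n (toFockW n k w x) := by
  rw [dFromW, LinearMap.comp_apply, toFockW_dW, LinearEquiv.coe_coe, toFockW_castCw]

lemma map_ZW (k : ℤ) (w : Fin n → ℤ) :
    (ZW n k w).map (toFockW n k w) = piece n k w ⊓ LinearMap.ker (bdF n) := by
  ext y
  constructor
  · rintro ⟨x, hx, rfl⟩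
    refine ⟨toFockW_mem k w x, ?_⟩
    change bdF n (toFockW n k w x) = 0
    rw [← toFockW_dFromW, LinearMap.mem_ker.1 hx, map_zero]
  · rintro ⟨hy, hy'⟩
    obtain ⟨x, rfl⟩ := (range_toFockW k w).symm ▸ hy
    refine ⟨x, toFockW_injective (k - 1) w ?_, rfl⟩
    rw [toFockW_dFromW, LinearMap.mem_ker.1 hy', map_zero]

lemma map_range_dW (k : ℤ) (w : Fin n → ℤ) :
    (LinearMap.range (dW n k w) ⊓ ZW n k w).map (toFockW n k w) =
      (piece n (k + 1) w).map (bdF n) := by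
  have h : (LinearMap.range (dW n k w)).map (toFockW n k w) = (piece n (k + 1) w).map (bdF n) := by
    rw [← range_toFockW, ← LinearMap.range_comp, ← LinearMap.range_comp]
    congr 1
    exact LinearMap.ext (toFockW_dW k w)
  rw [Submodule.map_inf _ (toFockW_injective k w), h, map_ZW, inf_eq_left]
  rintro _ ⟨x, hx, rfl⟩
  exact ⟨bdF_mem_piece hx, bdF_bdF x⟩

/-- The homology of a weight summand, computed in the Fock space. -/
theorem Hw_equiv (k : ℤ) (w : Fin n → ℤ) :
    Nonempty (Hw n k w ≃ₗ[ℤ] (↥(piece n k w ⊓ LinearMap.ker (bdF n)) ⧸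
      ((piece n (k + 1) w).map (bdF n)).comap
        (piece n k w ⊓ LinearMap.ker (bdF n)).subtype)) :=
  quotient_equiv_map (toFockW n k w) (toFockW_injective k w) (map_ZW k w) (map_range_dW k w)

end Comparison

/-- Lemma 4.3: for `w ∈ 𝒯_n`, `H_k⟦w_n, …, w₁⟧ ≅ H_{binom(n,2)-k-1}⟦w₁, …, w_n⟧`. -/
theorem torsion_duality (n : ℕ) (w : Fin n → ℤ) (hw : Sn n w)
    (hnp : ¬ ∃ π : Equiv.Perm (Fin n), w = permWt n π) :
    ∀ k : ℤ,
      Nonempty (Hw n k (fun i => w (rev i)) ≃ₗ[ℤ] Hw n ((n.choose 2 : ℤ) - k - 1) w) := by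
  intro k
  obtain ⟨e₁⟩ := Hw_equiv k fun i => w (rev i)
  obtain ⟨e₂⟩ := homology_equiv_cohomology_rev k w (sub_add_cancel ((n.choose 2 : ℤ) - k) 1)
  obtain ⟨e₃⟩ := homology_equiv_cohomology (exists_wt_eq hw hnp) ((n.choose 2 : ℤ) - k - 1)
  obtain ⟨e₄⟩ := Hw_equiv ((n.choose 2 : ℤ) - k - 1) w
  exact ⟨e₁.trans (e₂.trans (e₃.symm.trans e₄.symm))⟩

end Nil
end

section
/- For n = 4 and w = (2, 3, 2, 3) ∈ 𝒮_4, one has H_k⟦2, 3, 2, 3⟧ ≅ ℤ/2ℤ if k = 2 and H_k⟦2, 3, 2, 3⟧ = 0 otherwise. Consequently the torsion subgroup of H_k(𝔫𝔦𝔩_4; ℤ) is ℤ/2ℤ for k ∈ {2, 3} and trivial for all other k, and the full integral homology of 𝔫𝔦𝔩_4 is: H_0 ≅ ℤ, H_1 ≅ ℤ^3, H_2 ≅ ℤ^5 ⊕ ℤ/2, H_3 ≅ ℤ^6 ⊕ ℤ/2, H_4 ≅ ℤ^5, H_5 ≅ ℤ^3, H_6 ≅ ℤ, and H_k = 0 for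 k > 6. -/
namespace Nil

section Homology

variable {A B C Q : Type*} [AddCommGroup A] [AddCommGroup B] [AddCommGroup C] [AddCommGroup Q]

theorem nonempty_homology_equiv_of_linearMap (g : A →ₗ[ℤ] B) (f : B →ₗ[ℤ] C) (φ : B →ₗ[ℤ] Q)
    (hφg : ∀ x, φ (g x) = 0) (hsurj : ∀ y, ∃ x, f x = 0 ∧ φ x = y)
    (hexact : ∀ x, f x = 0 → φ x = 0 → ∃ z, g z = x) :
    Nonempty ((LinearMap.ker f ⧸ Submodule.comap (LinearMap.ker f).subtype
      (LinearMap.range g ⊓ LinearMap.ker f)) ≃ₗ[ℤ] Q) := by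
  have hker : Submodule.comap (LinearMap.ker f).subtype (LinearMap.range g ⊓ LinearMap.ker f) =
      LinearMap.ker (φ.domRestrict (LinearMap.ker f)) := by
    ext ⟨x, hx⟩
    constructor
    · rintro ⟨⟨z, rfl⟩, -⟩
      exact hφg z
    · intro h
      exact ⟨hexact x hx h, hx⟩
  have hφ : Function.Surjective (φ.domRestrict (LinearMap.ker f)) := fun y =>
    let ⟨x, hx, hxy⟩ := hsurj y
    ⟨⟨x, hx⟩, hxy⟩
  exact ⟨(Submodule.quotEquivOfEq _ _ hker).trans (LinearMap.quotKerEquivOfSurjective _ hφ)⟩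

/-- The homology at `B` of `A → B → C`, where the maps have matrices `G` and `F`, is the cokernel
of `T` as soon as `B` splits integrally, up to the factor `2`, as certified by the matrices
`S`, `R`, `H`, `K`, `U`, `V`. -/
theorem nonempty_homology_equiv_of_matrix {a b c q t : ℕ}
    (eA : A ≃ₗ[ℤ] (Fin a → ℤ)) (eB : B ≃ₗ[ℤ] (Fin b → ℤ)) (eC : C ≃ₗ[ℤ] (Fin c → ℤ))
    (g : A →ₗ[ℤ] B) (f : B →ₗ[ℤ] C)
    {G : Matrix (Fin b) (Fin a) ℤ} {F : Matrix (Fin c) (Fin b) ℤ}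
    (hg : ∀ x, eB (g x) = G.mulVec (eA x)) (hf : ∀ x, eC (f x) = F.mulVec (eB x))
    {T : Matrix (Fin q) (Fin t) ℤ} (π : (Fin q → ℤ) →ₗ[ℤ] Q) (hπ : Function.Surjective π)
    (hπT : ∀ y, π y = 0 ↔ ∃ z, y = T.mulVec z)
    (S : Matrix (Fin b) (Fin q) ℤ) (R : Matrix (Fin q) (Fin b) ℤ)
    (H : Matrix (Fin a) (Fin b) ℤ) (K : Matrix (Fin b) (Fin c) ℤ)
    (U : Matrix (Fin a) (Fin t) ℤ) (V : Matrix (Fin t) (Fin a) ℤ)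
    (h : R * G = T * V ∧ F * S = 0 ∧ R * S = 1 ∧
      (2 : ℤ) • (1 - G * H - S * R) = K * F ∧ S * T = G * U) :
    Nonempty ((LinearMap.ker f ⧸ Submodule.comap (LinearMap.ker f).subtype
      (LinearMap.range g ⊓ LinearMap.ker f)) ≃ₗ[ℤ] Q) := by
  obtain ⟨hRG, hFS, hRS, hsplit, hST⟩ := h
  refine nonempty_homology_equiv_of_linearMap g f (π ∘ₗ R.mulVecLin ∘ₗ eB.toLinearMap) ?_ ?_ ?_
  · intro x
    have : R.mulVec (eB (g x)) = T.mulVec (V.mulVec (eA x)) := by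
      rw [hg, Matrix.mulVec_mulVec, hRG, Matrix.mulVec_mulVec]
    exact (hπT _).2 ⟨_, this⟩
  · intro y
    obtain ⟨z, rfl⟩ := hπ y
    refine ⟨eB.symm (S.mulVec z), eC.injective ?_, ?_⟩
    · rw [hf, eB.apply_symm_apply, Matrix.mulVec_mulVec, hFS, Matrix.zero_mulVec, map_zero]
    · simp [Matrix.mulVec_mulVec, hRS]
  · intro x hx hRx
    obtain ⟨z, hz⟩ := (hπT _).1 hRx
    replace hz : R.mulVec (eB x) = T.mulVec z := hz
    have hFx : F.mulVec (eB x) = 0 := by rw [← hf, hx, map_zero]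
    have hzero : (2 : ℤ) • (1 - G * H - S * R).mulVec (eB x) = 0 := by
      rw [← Matrix.smul_mulVec, hsplit, ← Matrix.mulVec_mulVec, hFx, Matrix.mulVec_zero]
    have hx' : eB x = G.mulVec (H.mulVec (eB x) + U.mulVec z) := by
      have := (smul_eq_zero.1 hzero).resolve_left two_ne_zero
      rw [Matrix.sub_mulVec, Matrix.sub_mulVec, Matrix.one_mulVec, ← Matrix.mulVec_mulVec _ S R,
        hz, Matrix.mulVec_mulVec, hST, sub_sub, sub_eq_zero] at this
      rw [Matrix.mulVec_add, Matrix.mulVec_mulVec, Matrix.mulVec_mulVec]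
      exact this
    refine ⟨eA.symm (H.mulVec (eB x) + U.mulVec z), eB.injective ?_⟩
    rw [hg, eA.apply_symm_apply, ← hx']

/-- The projection of `ℤ^(r+1)` onto `ℤ^r × ℤ/2`. -/
def reduceLast (r : ℕ) : (Fin (r + 1) → ℤ) →ₗ[ℤ] (Fin r → ℤ) × ZMod 2 :=
  (LinearMap.funLeft ℤ ℤ Fin.castSucc).prod
    ((Int.castAddHom (ZMod 2)).toIntLinearMap ∘ₗ LinearMap.proj (Fin.last r))

/-- The relation matrix of `ℤ^r × ℤ/2`. -/
def twoLast (r : ℕ) : Matrix (Fin (r + 1)) (Fin 1) ℤ :=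
  fun i _ => if i = Fin.last r then 2 else 0

theorem reduceLast_surjective (r : ℕ) : Function.Surjective (reduceLast r) := by
  rintro ⟨v, z⟩
  obtain ⟨m, rfl⟩ := ZMod.intCast_surjective z
  refine ⟨Fin.snoc v m, Prod.ext (funext fun i => ?_) ?_⟩
  · simp [reduceLast, LinearMap.funLeft]
  · simp [reduceLast]

theorem reduceLast_eq_zero_iff (r : ℕ) (y : Fin (r + 1) → ℤ) :
    reduceLast r y = 0 ↔ ∃ z, y = (twoLast r).mulVec z := by
  have hmul (z : Fin 1 → ℤ) (i : Fin (r + 1)) :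
      (twoLast r).mulVec z i = if i = Fin.last r then 2 * z 0 else 0 := by
    simp [Matrix.mulVec, dotProduct, twoLast]
  constructor
  · intro h
    have hinit (i : Fin r) : y i.castSucc = 0 := congrFun (congrArg Prod.fst h) i
    have hlast : ((y (Fin.last r) : ℤ) : ZMod 2) = 0 := congrArg Prod.snd h
    obtain ⟨m, hm⟩ := (ZMod.intCast_zmod_eq_zero_iff_dvd _ 2).1 hlast
    refine ⟨fun _ => m, funext fun i => ?_⟩
    rw [hmul]
    refine Fin.lastCases ?_ (fun i => ?_) i
    · simpa using hm
    · simp [hinit, (Fin.castSucc_lt_last i).ne]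
  · rintro ⟨z, rfl⟩
    refine Prod.ext (funext fun i => ?_) ?_
    · change (twoLast r).mulVec z i.castSucc = 0
      simp [hmul, (Fin.castSucc_lt_last i).ne]
    · change (((twoLast r).mulVec z (Fin.last r) : ℤ) : ZMod 2) = 0
      rw [hmul, if_pos rfl]
      exact (ZMod.intCast_zmod_eq_zero_iff_dvd _ 2).2 (Dvd.intro _ rfl)

theorem id_eq_zero_iff_exists_mulVec {q : ℕ} (y : Fin q → ℤ) :
    (LinearMap.id : (Fin q → ℤ) →ₗ[ℤ] _) y = 0 ↔
      ∃ z, y = (0 : Matrix (Fin q) (Fin 0) ℤ).mulVec z := by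
  simp

end Homology

section Torsion

variable {M : Type*} [AddCommGroup M]

theorem subsingleton_torsion_of_equiv {r : ℕ} (e : M ≃ₗ[ℤ] (Fin r → ℤ)) :
    Subsingleton (Submodule.torsion ℤ M) := by
  refine ⟨fun ⟨x, hx⟩ ⟨y, hy⟩ => Subtype.ext ?_⟩
  have eq_zero (z : M) (hz : z ∈ Submodule.torsion ℤ M) : z = 0 := by
    obtain ⟨⟨m, hm⟩, hmz⟩ := (Submodule.mem_torsion_iff z).1 hz
    replace hmz : m • z = 0 := hmz
    have : m • e z = 0 := by rw [← map_smul, hmz, map_zero]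
    exact e.map_eq_zero_iff.1 ((smul_eq_zero.1 this).resolve_left (nonZeroDivisors.ne_zero hm))
  exact (eq_zero x hx).trans (eq_zero y hy).symm

theorem nonempty_torsion_equiv_of_equiv {r : ℕ} (e : M ≃ₗ[ℤ] (Fin r → ℤ) × ZMod 2) :
    Nonempty (Submodule.torsion ℤ M ≃ₗ[ℤ] ZMod 2) := by
  let φ : Submodule.torsion ℤ M →ₗ[ℤ] ZMod 2 :=
    LinearMap.snd ℤ _ _ ∘ₗ e.toLinearMap ∘ₗ (Submodule.torsion ℤ M).subtype
  refine ⟨LinearEquiv.ofBijective φ ⟨?_, fun z => ?_⟩⟩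
  · refine (injective_iff_map_eq_zero φ).2 fun ⟨x, hx⟩ hφ => Subtype.ext ?_
    obtain ⟨⟨m, hm⟩, hmx⟩ := (Submodule.mem_torsion_iff x).1 hx
    replace hmx : m • x = 0 := hmx
    have hm' : m • (e x).1 = 0 := by
      rw [← Prod.smul_fst, ← map_smul, hmx, map_zero, Prod.fst_zero]
    exact e.map_eq_zero_iff.1 (Prod.ext
      ((smul_eq_zero.1 hm').resolve_left (nonZeroDivisors.ne_zero hm)) hφ)
  · refine ⟨⟨e.symm (0, z), (Submodule.mem_torsion_iff _).2
      ⟨⟨2, mem_nonZeroDivisors_of_ne_zero two_ne_zero⟩, ?_⟩⟩, ?_⟩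
    · change (2 : ℤ) • e.symm (0, z) = 0
      rw [← map_smul, Prod.smul_mk, smul_zero, two_smul, CharTwo.add_self_eq_zero]
      exact map_zero _
    · simp [φ]

end Torsion

section Coefficients

/-- The coefficient of `e_N` in the boundary of `e_M`. -/
def coeff {n : ℕ} (M N : Finset (P n)) : ℤ :=
  ∑ a ∈ M, ∑ b ∈ M,
    if hab : a.1.2 = b.1.1 then
      (let c : P n := ⟨(a.1.1, b.1.2), lt_trans a.2 (by rw [hab]; exact b.2)⟩
       if insert c ((M.erase a).erase b) = N then (-1 : ℤ) ^ (pos M a + pos M b + pos N c) else 0)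
    else 0

variable {n : ℕ} {k : ℤ}

theorem dAux_apply (M : Finset (P n)) (N : B n k) : dAux k M N = coeff M N.1 := by
  obtain ⟨N, hN⟩ := N
  simp only [dAux, coeff, Finsupp.finsetSum_apply]
  refine Finset.sum_congr rfl fun a _ => Finset.sum_congr rfl fun b _ => ?_
  split_ifs with hab hcard heq heq
  · subst heq
    simp
  · simp [heq]
  · exact absurd (heq ▸ hN) hcard
  · rfl
  · rfl

theorem d_single_apply (M : B n (k + 1)) (N : B n k) :
    d n k (Finsupp.single M 1) N = coeff M.1 N.1 := by
  simp [d, dAux_apply]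

theorem dFrom_single_apply (M : B n k) (N : B n (k - 1)) :
    dFrom n k (Finsupp.single M 1) N = coeff M.1 N.1 := by
  simp [dFrom, castC, d_single_apply]

variable {w : Fin n → ℤ}

theorem projW_apply (x : C n k) (N : Bw n k w) : projW n k w x N = x ⟨N.1, N.2.1⟩ := by
  induction x using Finsupp.induction_linear with
  | zero => simp
  | add x y hx hy => simp [hx, hy]
  | single M c =>
    obtain ⟨M, hM⟩ := M
    obtain ⟨N, hN, hNw⟩ := N
    by_cases hw : wt M = w
    · simp [projW, hw, Finsupp.single_apply]
    · have : M ≠ N := fun h => hw (h ▸ hNw)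
      simp [projW, hw, this]

theorem dW_single_apply (M : Bw n (k + 1) w) (N : Bw n k w) :
    dW n k w (Finsupp.single M 1) N = coeff M.1 N.1 := by
  simp [dW, projW_apply, inclW, d_single_apply]

theorem dFromW_single_apply (M : Bw n k w) (N : Bw n (k - 1) w) :
    dFromW n k w (Finsupp.single M 1) N = coeff M.1 N.1 := by
  simp [dFromW, castCw, dW_single_apply]

end Coefficients

section Coordinates

variable {α β : Type*} {a b : ℕ}

/-- Coordinates on a free module whose basis is enumerated by `e`. -/
noncomputable def coord (e : Fin a ≃ α) : (α →₀ ℤ) ≃ₗ[ℤ] (Fin a → ℤ) :=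
  (Finsupp.domLCongr e.symm).trans (Finsupp.linearEquivFunOnFinite ℤ ℤ (Fin a))

theorem coord_apply (e : Fin a ≃ α) (x : α →₀ ℤ) (i : Fin a) : coord e x i = x (e i) :=
  rfl

theorem coord_map (eα : Fin a ≃ α) (eβ : Fin b ≃ β) (g : (α →₀ ℤ) →ₗ[ℤ] (β →₀ ℤ))
    (G : Matrix (Fin b) (Fin a) ℤ)
    (hG : ∀ i j, g (Finsupp.single (eα j) 1) (eβ i) = G i j) (x : α →₀ ℤ) :
    coord eβ (g x) = G.mulVec (coord eα x) := by
  suffices (coord eβ).toLinearMap ∘ₗ g = G.mulVecLin ∘ₗ (coord eα).toLinearMap from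
    LinearMap.congr_fun this x
  refine Finsupp.lhom_ext' fun m => LinearMap.ext_ring (funext fun i => ?_)
  obtain ⟨j, rfl⟩ := eα.surjective m
  have hj : coord eα (Finsupp.single (eα j) 1) = Pi.single j 1 := by
    ext l
    simp [coord_apply, Finsupp.single_apply_left eα.injective, Finsupp.single_apply,
      Pi.single_apply, eq_comm (a := j)]
  simp [coord_apply, hG, hj]

/-- The set of pairs whose keys are the binary digits of `c`. -/
def cell (c : ℕ) : Finset (P 4) := Finset.univ.filter fun p => c.testBit (key p)

/-- Enumeration of the wedges satisfying `p` by a list of codes. -/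
noncomputable def enum (l : List ℕ) (p : Finset (P 4) → Prop)
    (hinj : Function.Injective fun i : Fin l.length => cell (l.get i))
    (hp : ∀ M, p M ↔ ∃ i : Fin l.length, cell (l.get i) = M) :
    Fin l.length ≃ {M : Finset (P 4) // p M} :=
  Equiv.ofBijective (fun i => ⟨cell (l.get i), (hp _).2 ⟨i, rfl⟩⟩)
    ⟨fun _ _ h => hinj (congrArg Subtype.val h), fun ⟨M, hM⟩ =>
      let ⟨i, hi⟩ := (hp M).1 hM
      ⟨i, Subtype.ext hi⟩⟩

/-- The matrix with the given nonzero entries (row, column, value). -/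
def sparse {a b : ℕ} (l : List (ℕ × ℕ × ℤ)) : Matrix (Fin a) (Fin b) ℤ := fun i j =>
  (l.map fun t => if t.1 = i.1 ∧ t.2.1 = j.1 then t.2.2 else 0).sum

/-- Codes of the wedges of degree `k` for `n = 4`. -/
def codes : ℤ → List ℕ
  | 0 => [0]
  | 1 => [2, 4, 8, 64, 128, 2048]
  | 2 => [6, 10, 66, 130, 2050, 12, 68, 132, 2052, 72, 136, 2056, 192, 2112, 2176]
  | 3 => [14, 70, 134, 2054, 74, 138, 2058, 194, 2114, 2178, 76, 140, 2060, 196, 2116, 2180, 200,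
      2120, 2184, 2240]
  | 4 => [78, 142, 2062, 198, 2118, 2182, 202, 2122, 2186, 2242, 204, 2124, 2188, 2244, 2248]
  | 5 => [206, 2126, 2190, 2246, 2250, 2252]
  | 6 => [2254]
  | _ => []

/-- The matrix of the boundary from degree `l = k + 1` to degree `k` for `n = 4`. -/
def boundary (k l : ℤ) : Matrix (Fin (codes k).length) (Fin (codes l).length) ℤ :=
  sparse <| match k with
  | 1 => [(1, 2, -1), (2, 3, -1), (2, 8, -1), (4, 13, -1)]
  | 2 => [(1, 3, 1), (3, 8, 1), (5, 2, -1), (5, 4, 1), (7, 7, -1), (7, 14, 1), (8, 8, -1),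
      (9, 7, 1), (9, 14, 1), (10, 15, 1), (10, 17, 1), (11, 9, -1)]
  | 3 => [(2, 4, -1), (4, 4, -1), (5, 5, -1), (5, 7, -1), (10, 3, 1), (11, 6, 1), (11, 11, -1),
      (12, 5, -1), (12, 7, 1), (15, 9, -1), (16, 13, -1), (17, 9, 1)]
  | 4 => [(1, 1, 1), (6, 3, 1), (11, 3, 1), (12, 4, 1)]
  | _ => []

theorem cell_codes_injective : ∀ k ∈ Finset.Icc (-1 : ℤ) 7,
    Function.Injective fun i : Fin (codes k).length => cell ((codes k).get i) := by
  decide +kernel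

theorem card_eq_iff_exists_code : ∀ k ∈ Finset.Icc (-1 : ℤ) 7, ∀ M : Finset (P 4),
    (M.card : ℤ) = k ↔ ∃ i : Fin (codes k).length, cell ((codes k).get i) = M := by
  decide +kernel

theorem coeff_cell_codes_succ : ∀ k ∈ Finset.Icc (-1 : ℤ) 6,
    (Matrix.of fun i j => coeff (cell ((codes (k + 1)).get j)) (cell ((codes k).get i))) =
      boundary k (k + 1) := by
  decide +kernel

theorem coeff_cell_codes {k l : ℤ} (hk : k ∈ Finset.Icc (-1 : ℤ) 6) (hl : k + 1 = l)
    (i : Fin (codes k).length) (j : Fin (codes l).length) :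
    coeff (cell ((codes l).get j)) (cell ((codes k).get i)) = boundary k l i j := by
  subst hl
  exact congrFun₂ (coeff_cell_codes_succ k hk) i j

end Coordinates

section Equivalences

variable {Q : Type*} [AddCommGroup Q] {q t : ℕ}

theorem nonempty_hnil_equiv (k : ℤ) (hk : k ∈ Finset.Icc (0 : ℤ) 6)
    {T : Matrix (Fin q) (Fin t) ℤ} (π : (Fin q → ℤ) →ₗ[ℤ] Q) (hπ : Function.Surjective π)
    (hπT : ∀ y, π y = 0 ↔ ∃ z, y = T.mulVec z)
    (S : Matrix (Fin (codes k).length) (Fin q) ℤ) (R : Matrix (Fin q) (Fin (codes k).length) ℤ)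
    (H : Matrix (Fin (codes (k + 1)).length) (Fin (codes k).length) ℤ)
    (K : Matrix (Fin (codes k).length) (Fin (codes (k - 1)).length) ℤ)
    (U : Matrix (Fin (codes (k + 1)).length) (Fin t) ℤ)
    (V : Matrix (Fin t) (Fin (codes (k + 1)).length) ℤ)
    (h : R * boundary k (k + 1) = T * V ∧ boundary (k - 1) k * S = 0 ∧ R * S = 1 ∧
      (2 : ℤ) • (1 - boundary k (k + 1) * H - S * R) = K * boundary (k - 1) k ∧
      S * T = boundary k (k + 1) * U) :
    Nonempty (Hnil 4 k ≃ₗ[ℤ] Q) := by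
  rw [Finset.mem_Icc] at hk
  have hmem (l : ℤ) (hl : k - 1 ≤ l ∧ l ≤ k + 1) : l ∈ Finset.Icc (-1 : ℤ) 7 :=
    Finset.mem_Icc.2 (by lia)
  let e (l : ℤ) (hl : k - 1 ≤ l ∧ l ≤ k + 1) : Fin (codes l).length ≃ B 4 l :=
    enum (codes l) _ (cell_codes_injective l (hmem l hl)) (card_eq_iff_exists_code l (hmem l hl))
  exact nonempty_homology_equiv_of_matrix (coord (e (k + 1) (by lia))) (coord (e k (by lia)))
    (coord (e (k - 1) (by lia))) (d 4 k) (dFrom 4 k)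
    (coord_map _ _ _ _ fun i j => (d_single_apply _ _).trans
      (coeff_cell_codes (Finset.mem_Icc.2 (by lia)) rfl i j))
    (coord_map _ _ _ _ fun i j => (dFrom_single_apply _ _).trans
      (coeff_cell_codes (Finset.mem_Icc.2 (by lia)) (by ring) i j))
    π hπ hπT S R H K U V h

theorem subsingleton_hnil {k : ℤ} (hk : k ∉ Finset.Icc (0 : ℤ) 6) : Subsingleton (Hnil 4 k) := by
  have : IsEmpty (B 4 k) := ⟨fun ⟨M, hM⟩ => hk <| by
    have hcard : M.card ≤ 6 := M.card_le_univ
    exact Finset.mem_Icc.2 (by lia)⟩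
  exact (Submodule.mkQ_surjective (HnilSub 4 k)).subsingleton

/-- Codes of the wedges of degree `k` and modified weight `(2, 3, 2, 3)`. -/
def codesW : ℤ → List ℕ
  | 2 => [132, 72]
  | 3 => [194, 2116]
  | _ => []

/-- The boundary matrix from degree `l = k + 1` to degree `k` in modified weight
`(2, 3, 2, 3)`. -/
def boundaryW (k l : ℤ) : Matrix (Fin (codesW k).length) (Fin (codesW l).length) ℤ :=
  sparse <| match k with
  | 2 => [(0, 0, -1), (0, 1, 1), (1, 0, 1), (1, 1, 1)]
  | _ => []

theorem cell_codesW_injective : ∀ k ∈ Finset.Icc (1 : ℤ) 4,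
    Function.Injective fun i : Fin (codesW k).length => cell ((codesW k).get i) := by
  decide +kernel

theorem weight_eq_iff_exists_code : ∀ k ∈ Finset.Icc (1 : ℤ) 4, ∀ M : Finset (P 4),
    (M.card : ℤ) = k ∧ wt M = ![2, 3, 2, 3] ↔
      ∃ i : Fin (codesW k).length, cell ((codesW k).get i) = M := by
  decide +kernel

theorem coeff_cell_codesW_succ : ∀ k ∈ Finset.Icc (1 : ℤ) 3,
    (Matrix.of fun i j => coeff (cell ((codesW (k + 1)).get j)) (cell ((codesW k).get i))) =
      boundaryW k (k + 1) := by
  decide +kernel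

theorem coeff_cell_codesW {k l : ℤ} (hk : k ∈ Finset.Icc (1 : ℤ) 3) (hl : k + 1 = l)
    (i : Fin (codesW k).length) (j : Fin (codesW l).length) :
    coeff (cell ((codesW l).get j)) (cell ((codesW k).get i)) = boundaryW k l i j := by
  subst hl
  exact congrFun₂ (coeff_cell_codesW_succ k hk) i j

theorem nonempty_hw_equiv (k : ℤ) (hk : k ∈ Finset.Icc (2 : ℤ) 3)
    {T : Matrix (Fin q) (Fin t) ℤ} (π : (Fin q → ℤ) →ₗ[ℤ] Q) (hπ : Function.Surjective π)
    (hπT : ∀ y, π y = 0 ↔ ∃ z, y = T.mulVec z)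
    (S : Matrix (Fin (codesW k).length) (Fin q) ℤ) (R : Matrix (Fin q) (Fin (codesW k).length) ℤ)
    (H : Matrix (Fin (codesW (k + 1)).length) (Fin (codesW k).length) ℤ)
    (K : Matrix (Fin (codesW k).length) (Fin (codesW (k - 1)).length) ℤ)
    (U : Matrix (Fin (codesW (k + 1)).length) (Fin t) ℤ)
    (V : Matrix (Fin t) (Fin (codesW (k + 1)).length) ℤ)
    (h : R * boundaryW k (k + 1) = T * V ∧ boundaryW (k - 1) k * S = 0 ∧ R * S = 1 ∧
      (2 : ℤ) • (1 - boundaryW k (k + 1) * H - S * R) = K * boundaryW (k - 1) k ∧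
      S * T = boundaryW k (k + 1) * U) :
    Nonempty (Hw 4 k ![2, 3, 2, 3] ≃ₗ[ℤ] Q) := by
  rw [Finset.mem_Icc] at hk
  have hmem (l : ℤ) (hl : k - 1 ≤ l ∧ l ≤ k + 1) : l ∈ Finset.Icc (1 : ℤ) 4 :=
    Finset.mem_Icc.2 (by lia)
  let e (l : ℤ) (hl : k - 1 ≤ l ∧ l ≤ k + 1) : Fin (codesW l).length ≃ Bw 4 l ![2, 3, 2, 3] :=
    enum (codesW l) _ (cell_codesW_injective l (hmem l hl))
      (weight_eq_iff_exists_code l (hmem l hl))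
  exact nonempty_homology_equiv_of_matrix (coord (e (k + 1) (by lia))) (coord (e k (by lia)))
    (coord (e (k - 1) (by lia))) (dW 4 k _) (dFromW 4 k _)
    (coord_map _ _ _ _ fun i j => (dW_single_apply _ _).trans
      (coeff_cell_codesW (Finset.mem_Icc.2 (by lia)) rfl i j))
    (coord_map _ _ _ _ fun i j => (dFromW_single_apply _ _).trans
      (coeff_cell_codesW (Finset.mem_Icc.2 (by lia)) (by ring) i j))
    π hπ hπT S R H K U V h

theorem card_mem_of_weight_eq : ∀ M : Finset (P 4), wt M = ![2, 3, 2, 3] →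
    (M.card : ℤ) ∈ Finset.Icc (2 : ℤ) 3 := by
  decide +kernel

theorem subsingleton_hw {k : ℤ} (hk : k ∉ Finset.Icc (2 : ℤ) 3) :
    Subsingleton (Hw 4 k ![2, 3, 2, 3]) := by
  have : IsEmpty (Bw 4 k ![2, 3, 2, 3]) :=
    ⟨fun ⟨M, hM, hw⟩ => hk (hM ▸ card_mem_of_weight_eq M hw)⟩
  exact (Submodule.mkQ_surjective (HwSub 4 k ![2, 3, 2, 3])).subsingleton

end Equivalences

theorem nonempty_hw_two_equiv : Nonempty (Hw 4 2 ![2, 3, 2, 3] ≃ₗ[ℤ] ZMod 2) := by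
  obtain ⟨e⟩ := nonempty_hw_equiv 2 (by decide) (reduceLast 0) (reduceLast_surjective 0)
    (reduceLast_eq_zero_iff 0)
    (sparse [(1, 0, 1)]) (sparse [(0, 0, 1), (0, 1, 1)]) (sparse [(0, 0, -1)]) 0
    (sparse [(0, 0, 1), (1, 0, 1)]) (sparse [(0, 1, 1)]) (by decide +kernel)
  exact ⟨e.trans LinearEquiv.uniqueProd⟩

theorem subsingleton_hw_three : Subsingleton (Hw 4 3 ![2, 3, 2, 3]) := by
  obtain ⟨e⟩ := nonempty_hw_equiv (q := 0) 3 (by decide) LinearMap.id Function.surjective_id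
    id_eq_zero_iff_exists_mulVec 0 0 0
    (sparse [(0, 0, -1), (0, 1, 1), (1, 0, 1), (1, 1, 1)]) 0 0 (by decide +kernel)
  exact e.toEquiv.subsingleton

theorem nonempty_hnil_zero_equiv : Nonempty (Hnil 4 0 ≃ₗ[ℤ] (Fin 1 → ℤ)) :=
  nonempty_hnil_equiv 0 (by decide) LinearMap.id Function.surjective_id
    id_eq_zero_iff_exists_mulVec
    (sparse [(0, 0, 1)])
    (sparse [(0, 0, 1)])
    0 0 0 0 (by decide +kernel)

theorem nonempty_hnil_one_equiv : Nonempty (Hnil 4 1 ≃ₗ[ℤ] (Fin 3 → ℤ)) :=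
  nonempty_hnil_equiv 1 (by decide) LinearMap.id Function.surjective_id
    id_eq_zero_iff_exists_mulVec
    (sparse [(0, 0, 1), (3, 1, 1), (5, 2, 1)])
    (sparse [(0, 0, 1), (1, 3, 1), (2, 5, 1)])
    (sparse [(2, 1, -1), (3, 2, -1), (13, 4, -1)])
    0 0 0 (by decide +kernel)

theorem nonempty_hnil_two_equiv : Nonempty (Hnil 4 2 ≃ₗ[ℤ] (Fin 5 → ℤ) × ZMod 2) :=
  nonempty_hnil_equiv 2 (by decide) (reduceLast 5) (reduceLast_surjective 5)
    (reduceLast_eq_zero_iff 5)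
    (sparse [(0, 0, 1), (4, 1, 1), (6, 2, 1), (9, 5, 1), (12, 3, 1), (14, 4, 1)])
    (sparse [(0, 0, 1), (1, 4, 1), (2, 6, 1), (3, 12, 1), (4, 14, 1), (5, 7, 1), (5, 9, 1)])
    (sparse [(2, 5, -1), (3, 1, 1), (7, 7, -1), (8, 8, -1), (9, 11, -1), (15, 10, 1)])
    (sparse [(2, 1, -2), (3, 2, -2), (13, 4, -2)])
    (sparse [(7, 0, 1), (14, 0, 1)])
    (sparse [(0, 14, 1)])
    (by decide +kernel)

theorem nonempty_hnil_three_equiv : Nonempty (Hnil 4 3 ≃ₗ[ℤ] (Fin 6 → ℤ) × ZMod 2) :=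
  nonempty_hnil_equiv 3 (by decide) (reduceLast 6) (reduceLast_surjective 6)
    (reduceLast_eq_zero_iff 6)
    (sparse [(0, 0, 1), (1, 1, 1), (6, 2, 1), (12, 6, 1), (13, 3, 1), (18, 4, 1), (19, 5, 1)])
    (sparse [(0, 0, 1), (1, 1, 1), (2, 6, 1), (3, 13, 1), (4, 18, 1), (5, 19, 1), (6, 5, -1),
      (6, 12, 1)])
    (sparse [(3, 10, 1), (4, 4, -1), (5, 5, -1), (6, 11, 1), (9, 17, 1), (13, 16, -1)])
    (sparse [(2, 5, -2), (3, 1, 2), (7, 7, -1), (7, 9, 1), (8, 8, -2), (9, 11, -2), (14, 7, 1),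
      (14, 9, 1), (15, 10, 2)])
    (sparse [(5, 0, -1), (7, 0, 1)])
    (sparse [(0, 7, 1)])
    (by decide +kernel)

theorem nonempty_hnil_four_equiv : Nonempty (Hnil 4 4 ≃ₗ[ℤ] (Fin 5 → ℤ)) :=
  nonempty_hnil_equiv 4 (by decide) LinearMap.id Function.surjective_id
    id_eq_zero_iff_exists_mulVec
    (sparse [(0, 0, 1), (2, 1, 1), (8, 2, 1), (10, 3, 1), (14, 4, 1)])
    (sparse [(0, 0, 1), (1, 2, 1), (2, 8, 1), (3, 10, 1), (4, 14, 1)])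
    (sparse [(1, 1, 1), (3, 11, 1), (4, 12, 1)])
    (sparse [(3, 10, 2), (4, 4, -2), (5, 5, -1), (5, 12, -1), (6, 11, 2), (7, 5, -1), (7, 12, 1),
      (9, 17, 2), (13, 16, -2)])
    0 0 (by decide +kernel)

theorem nonempty_hnil_five_equiv : Nonempty (Hnil 4 5 ≃ₗ[ℤ] (Fin 3 → ℤ)) :=
  nonempty_hnil_equiv 5 (by decide) LinearMap.id Function.surjective_id
    id_eq_zero_iff_exists_mulVec
    (sparse [(0, 0, 1), (2, 1, 1), (5, 2, 1)])
    (sparse [(0, 0, 1), (1, 2, 1), (2, 5, 1)])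
    0
    (sparse [(1, 1, 2), (3, 11, 2), (4, 12, 2)])
    0 0 (by decide +kernel)

theorem nonempty_hnil_six_equiv : Nonempty (Hnil 4 6 ≃ₗ[ℤ] (Fin 1 → ℤ)) :=
  nonempty_hnil_equiv 6 (by decide) LinearMap.id Function.surjective_id
    id_eq_zero_iff_exists_mulVec
    (sparse [(0, 0, 1)])
    (sparse [(0, 0, 1)])
    0 0 0 0 (by decide +kernel)

/-- `H_k⟦2,3,2,3⟧ ≅ ℤ/2` for `k = 2` and vanishes otherwise; the torsion of
`H_k(nil_4; ℤ)` is `ℤ/2` exactly for `k ∈ {2,3}`; and the full integral homology of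
`nil_4` is `ℤ, ℤ³, ℤ⁵⊕ℤ/2, ℤ⁶⊕ℤ/2, ℤ⁵, ℤ³, ℤ` in degrees `0,…,6` and `0` above. -/
theorem nil4_homology :
    (Nonempty (Hw 4 2 ![2, 3, 2, 3] ≃ₗ[ℤ] ZMod 2) ∧
      ∀ k : ℤ, k ≠ 2 → Subsingleton (Hw 4 k ![2, 3, 2, 3])) ∧
    (Nonempty ((Submodule.torsion ℤ (Hnil 4 2)) ≃ₗ[ℤ] ZMod 2) ∧
      Nonempty ((Submodule.torsion ℤ (Hnil 4 3)) ≃ₗ[ℤ] ZMod 2) ∧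
      ∀ k : ℤ, k ≠ 2 → k ≠ 3 → Subsingleton (Submodule.torsion ℤ (Hnil 4 k))) ∧
    Nonempty (Hnil 4 0 ≃ₗ[ℤ] ℤ) ∧
    Nonempty (Hnil 4 1 ≃ₗ[ℤ] (Fin 3 → ℤ)) ∧
    Nonempty (Hnil 4 2 ≃ₗ[ℤ] (Fin 5 → ℤ) × ZMod 2) ∧
    Nonempty (Hnil 4 3 ≃ₗ[ℤ] (Fin 6 → ℤ) × ZMod 2) ∧
    Nonempty (Hnil 4 4 ≃ₗ[ℤ] (Fin 5 → ℤ)) ∧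
    Nonempty (Hnil 4 5 ≃ₗ[ℤ] (Fin 3 → ℤ)) ∧
    Nonempty (Hnil 4 6 ≃ₗ[ℤ] ℤ) ∧
    (∀ k : ℤ, 6 < k → Subsingleton (Hnil 4 k)) := by
  have hnil (k : ℤ) (hk2 : k ≠ 2) (hk3 : k ≠ 3) :
      Subsingleton (Submodule.torsion ℤ (Hnil 4 k)) := by
    by_cases hk : k ∈ Finset.Icc (0 : ℤ) 6
    · obtain ⟨h0, h6⟩ := Finset.mem_Icc.1 hk
      interval_cases k
      · exact nonempty_hnil_zero_equiv.elim subsingleton_torsion_of_equiv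
      · exact nonempty_hnil_one_equiv.elim subsingleton_torsion_of_equiv
      · exact absurd rfl hk2
      · exact absurd rfl hk3
      · exact nonempty_hnil_four_equiv.elim subsingleton_torsion_of_equiv
      · exact nonempty_hnil_five_equiv.elim subsingleton_torsion_of_equiv
      · exact nonempty_hnil_six_equiv.elim subsingleton_torsion_of_equiv
    · have := subsingleton_hnil hk
      infer_instance
  refine ⟨⟨nonempty_hw_two_equiv, fun k hk => ?_⟩,
    ⟨nonempty_hnil_two_equiv.elim nonempty_torsion_equiv_of_equiv,
      nonempty_hnil_three_equiv.elim nonempty_torsion_equiv_of_equiv, hnil⟩,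
    nonempty_hnil_zero_equiv.map fun e => e.trans (LinearEquiv.funUnique (Fin 1) ℤ ℤ),
    nonempty_hnil_one_equiv, nonempty_hnil_two_equiv, nonempty_hnil_three_equiv,
    nonempty_hnil_four_equiv, nonempty_hnil_five_equiv,
    nonempty_hnil_six_equiv.map fun e => e.trans (LinearEquiv.funUnique (Fin 1) ℤ ℤ),
    fun k hk => subsingleton_hnil (by simp; lia)⟩
  by_cases hk3 : k = 3
  · subst hk3
    exact subsingleton_hw_three
  · exact subsingleton_hw (by simp; lia)

end Nil
end
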